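/- arXiv:1803.06922 — 3 statements merged into one kernel-verified Lean document; each statement's English description precedes it below -/
import Mathlib

section
/- Let X be a centered d-dimensional Gaussian random vector with non-singular correlation matrix \Sigma and let c \in R^d have at least one positive component, with I and L the index sets determined by \Pi_\Sigma(c). Assume 1 \in L^c. Then \tilde c_1 = \Sigma_{1,I}(\Sigma_{II})^{-1} c_I > c_1 and (X_1 - \tilde c_1 u) conditional on (X > c u) converges in distribution, as u \to \infty, to a random variable Y with survival function \bar G(x) = P(X_1 > x | X_I = 0_I) if L = I, and, with N* = L \setminus I non-empty, \bar G(x) = P(X_1 > x, X_{N*} > 0_{N*} | X_I = 0_I) / P(X_{N*} > 0_{N*} | X_I = 0_I). -/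
open MeasureTheory ProbabilityTheory Filter Matrix
open scoped Topology ENNReal

noncomputable section

/-- Submatrix of `A` keeping rows with indices in `I` and columns with indices in `J`. -/
def subM {ι : Type*} (A : Matrix ι ι ℝ) (I J : Finset ι) : Matrix ↥I ↥J ℝ :=
  fun i j => A i j

/-- Subvector of `c` keeping the entries with indices in `I`. -/
def subV {ι : Type*} (c : ι → ℝ) (I : Finset ι) : ↥I → ℝ := fun i => c i

/-- Density of a centered Gaussian vector with covariance matrix `S`. -/
def gaussPDF {ι : Type*} [Fintype ι] [DecidableEq ι] (S : Matrix ι ι ℝ) (x : ι → ℝ) : ℝ :=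
  (Real.sqrt ((2 * Real.pi) ^ Fintype.card ι * S.det))⁻¹ *
    Real.exp (-(x ⬝ᵥ S⁻¹.mulVec x) / 2)

/-- `X` is, under `P`, a centered Gaussian random vector with covariance matrix `S`. -/
def IsCenteredGaussianRV {Ω ι : Type*} [MeasurableSpace Ω] [Fintype ι] [DecidableEq ι]
    (P : Measure Ω) (X : Ω → ι → ℝ) (S : Matrix ι ι ℝ) : Prop :=
  Measure.map X P =
    (volume : Measure (ι → ℝ)).withDensity fun x => ENNReal.ofReal (gaussPDF S x)

/-- `bt` is a solution of the quadratic programming problem `Π_A(c)`: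
minimise `x ⬝ Σ⁻¹ x` under `x ≥ c`. -/
def IsQPSol {ι : Type*} [Fintype ι] [DecidableEq ι] (A : Matrix ι ι ℝ) (c bt : ι → ℝ) : Prop :=
  (∀ i, c i ≤ bt i) ∧
    ∀ x : ι → ℝ, (∀ i, c i ≤ x i) → bt ⬝ᵥ A⁻¹.mulVec bt ≤ x ⬝ᵥ A⁻¹.mulVec x

/-- `I` is the index set determined by the quadratic programming problem `Π_A(c)`
with solution `bt`. -/
def IsQPIndex {ι : Type*} [Fintype ι] [DecidableEq ι] (A : Matrix ι ι ℝ)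
    (c bt : ι → ℝ) (I : Finset ι) : Prop :=
  I.Nonempty ∧ (∀ i ∈ I, bt i = c i) ∧
    (∀ i : ↥I, 0 < (subM A I I)⁻¹.mulVec (subV c I) i) ∧
    ∀ j : ι, j ∉ I → bt j = (fun i : ↥I => A j i) ⬝ᵥ (subM A I I)⁻¹.mulVec (subV c I)

/-- `Σ_{i₀,I} (Σ_{II})⁻¹ c_I`. -/
def rowDot {ι : Type*} [Fintype ι] [DecidableEq ι] (A : Matrix ι ι ℝ) (c : ι → ℝ)
    (I : Finset ι) (i0 : ι) : ℝ :=
  (fun i : ↥I => A i0 i) ⬝ᵥ (subM A I I)⁻¹.mulVec (subV c I)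

/-- `c_I ⬝ (Σ_{II})⁻¹ e_{i₀}`. -/
def eDot {ι : Type*} [Fintype ι] [DecidableEq ι] (A : Matrix ι ι ℝ) (c : ι → ℝ)
    (I : Finset ι) (i0 : ι) : ℝ :=
  subV c I ⬝ᵥ (subM A I I)⁻¹.mulVec fun j : ↥I => if (j : ι) = i0 then 1 else 0

/-- Schur complement `Σ_{I^cI^c} - Σ_{I^cI}(Σ_{II})⁻¹Σ_{II^c}`, the covariance matrix of the
conditional Gaussian distribution of `X_{I^c}` given `X_I`. -/
def schurC {ι : Type*} [Fintype ι] [DecidableEq ι] (A : Matrix ι ι ℝ) (I : Finset ι) :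
    Matrix ↥Iᶜ ↥Iᶜ ℝ :=
  subM A Iᶜ Iᶜ - subM A Iᶜ I * (subM A I I)⁻¹ * subM A I Iᶜ

/-- The conditional law of `X_{I^c}` given `X_I = 0`. -/
def condNu {ι : Type*} [Fintype ι] [DecidableEq ι] (A : Matrix ι ι ℝ) (I : Finset ι) :
    Measure (↥Iᶜ → ℝ) :=
  (volume : Measure (↥Iᶜ → ℝ)).withDensity fun y => ENNReal.ofReal (gaussPDF (schurC A I) y)

/-- Survival function `Ḡ(x) = P(X_{i₀} > x, X_{N*} > 0 | X_I = 0) / P(X_{N*} > 0 | X_I = 0)`. -/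
def Gbar {ι : Type*} [Fintype ι] [DecidableEq ι] (A : Matrix ι ι ℝ) (I Nstar : Finset ι)
    (i0 : ι) (x : ℝ) : ℝ :=
  (condNu A I {y : ↥Iᶜ → ℝ | (∀ j : ↥Iᶜ, (j : ι) = i0 → x < y j) ∧
      ∀ j : ↥Iᶜ, (j : ι) ∈ Nstar → 0 < y j}).toReal /
    (condNu A I {y : ↥Iᶜ → ℝ | ∀ j : ↥Iᶜ, (j : ι) ∈ Nstar → 0 < y j}).toReal

/-- `E[(Y - μ)₊]` where `Y` has survival function `Gbar A I Nstar i0`. -/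
def condPlusMean {ι : Type*} [Fintype ι] [DecidableEq ι] (A : Matrix ι ι ℝ)
    (I Nstar : Finset ι) (i0 : ι) (μ : ℝ) : ℝ :=
  (∫ y in {y : ↥Iᶜ → ℝ | ∀ j : ↥Iᶜ, (j : ι) ∈ Nstar → 0 < y j},
      max ((∑ j : ↥Iᶜ, if (j : ι) = i0 then y j else 0) - μ) 0 ∂(condNu A I)) /
    (condNu A I {y : ↥Iᶜ → ℝ | ∀ j : ↥Iᶜ, (j : ι) ∈ Nstar → 0 < y j}).toReal

/-- `E[Y]` where `Y` has survival function `Gbar A I Nstar i0`. -/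
def condMean {ι : Type*} [Fintype ι] [DecidableEq ι] (A : Matrix ι ι ℝ)
    (I Nstar : Finset ι) (i0 : ι) : ℝ :=
  (∫ y in {y : ↥Iᶜ → ℝ | ∀ j : ↥Iᶜ, (j : ι) ∈ Nstar → 0 < y j},
      (∑ j : ↥Iᶜ, if (j : ι) = i0 then y j else 0) ∂(condNu A I)) /
    (condNu A I {y : ↥Iᶜ → ℝ | ∀ j : ↥Iᶜ, (j : ι) ∈ Nstar → 0 < y j}).toReal

/-- The conditioning event `{X_2 > c_2 u, ..., X_d > c_d u}`. -/
def tailEvent {Ω : Type*} {d : ℕ} [NeZero d] (X : Ω → Fin d → ℝ) (c : Fin d → ℝ) (u : ℝ) :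
    Set Ω := {ω | ∀ i : Fin d, i ≠ 0 → c i * u < X ω i}

/-- The marginal mean excess `E(c,u) = E[(X_1 - c_1 u - μ)₊ | X_2 > c_2 u, ..., X_d > c_d u]`. -/
def mmeV {Ω : Type*} [MeasurableSpace Ω] {d : ℕ} [NeZero d] (P : Measure Ω)
    (X : Ω → Fin d → ℝ) (c : Fin d → ℝ) (μ u : ℝ) : ℝ :=
  (∫ ω in tailEvent X c u, max (X ω 0 - c 0 * u - μ) 0 ∂P) / (P (tailEvent X c u)).toReal

/-- The marginal expected shortfall `S(c,u) = E[X_1 | X_2 > c_2 u, ..., X_d > c_d u]`. -/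
def mesV {Ω : Type*} [MeasurableSpace Ω] {d : ℕ} [NeZero d] (P : Measure Ω)
    (X : Ω → Fin d → ℝ) (c : Fin d → ℝ) (u : ℝ) : ℝ :=
  (∫ ω in tailEvent X c u, X ω 0 ∂P) / (P (tailEvent X c u)).toReal

/-- The multivariate conditional tail expectation `M(c,u) = E[X_1 | X > c u]`. -/
def mcteV {Ω : Type*} [MeasurableSpace Ω] {d : ℕ} [NeZero d] (P : Measure Ω)
    (X : Ω → Fin d → ℝ) (c : Fin d → ℝ) (u : ℝ) : ℝ :=
  (∫ ω in {ω | ∀ i, c i * u < X ω i}, X ω 0 ∂P) / (P {ω | ∀ i, c i * u < X ω i}).toReal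

/-- The index set `{2,...,d}` of the components of `X_{-1}`. -/
def offFirst (d : ℕ) [NeZero d] : Finset (Fin d) := Finset.univ.filter fun i => i ≠ 0

lemma pd_lower {ι : Type*} [Fintype ι] [DecidableEq ι] (B : Matrix ι ι ℝ) (hB : B.PosDef) :
    ∃ m : ℝ, 0 < m ∧ ∀ x : ι → ℝ, m * ∑ i, x i ^ 2 ≤ x ⬝ᵥ B.mulVec x := by
  have hpos : ∀ x : ι → ℝ, x ≠ 0 → 0 < x ⬝ᵥ B.mulVec x := fun x hx => by
    simpa using hB.dotProduct_mulVec_pos hx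
  have hcont : Continuous fun x : ι → ℝ => x ⬝ᵥ B.mulVec x := by
    unfold dotProduct mulVec dotProduct
    fun_prop
  by_cases hne : (Metric.sphere (0 : ι → ℝ) 1).Nonempty
  · obtain ⟨y, hy, hmin⟩ := (isCompact_sphere (0 : ι → ℝ) 1).exists_isMinOn hne hcont.continuousOn
    have hy0 : y ≠ 0 := by
      rintro rfl
      simp at hy
    set m0 := y ⬝ᵥ B.mulVec y with hm0
    have hm0p : 0 < m0 := hpos y hy0
    refine ⟨m0 / (Fintype.card ι + 1), by positivity, fun x => ?_⟩
    by_cases hx : x = 0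
    · subst hx; simp
    have hxn : 0 < ‖x‖ := norm_pos_iff.mpr hx
    have h1 : m0 ≤ (‖x‖⁻¹ • x) ⬝ᵥ B.mulVec (‖x‖⁻¹ • x) := by
      apply hmin
      simp [norm_smul, hxn.ne']
    rw [mulVec_smul, dotProduct_smul, smul_dotProduct, smul_eq_mul, smul_eq_mul] at h1
    have h2 : m0 * ‖x‖ ^ 2 ≤ x ⬝ᵥ B.mulVec x := by
      have := mul_le_mul_of_nonneg_right h1 (sq_nonneg ‖x‖)
      calc _ ≤ _ := this
        _ = _ := by field_simp
    have h3 : ∑ i, x i ^ 2 ≤ (Fintype.card ι + 1) * ‖x‖ ^ 2 := by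
      calc ∑ i, x i ^ 2 ≤ ∑ i : ι, ‖x‖ ^ 2 := by
            refine Finset.sum_le_sum fun i _ => ?_
            have := norm_le_pi_norm x i
            rw [Real.norm_eq_abs] at this
            rw [← sq_abs]
            gcongr
        _ = Fintype.card ι * ‖x‖ ^ 2 := by simp
        _ ≤ _ := by gcongr; linarith
    calc m0 / (Fintype.card ι + 1) * ∑ i, x i ^ 2
        ≤ m0 / (Fintype.card ι + 1) * ((Fintype.card ι + 1) * ‖x‖ ^ 2) := by gcongr
      _ = m0 * ‖x‖ ^ 2 := by field_simp
      _ ≤ _ := h2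
  · refine ⟨1, one_pos, fun x => ?_⟩
    have : x = 0 := by
      by_contra hx
      have hxn : 0 < ‖x‖ := norm_pos_iff.mpr hx
      exact hne ⟨‖x‖⁻¹ • x, by simp [norm_smul, hxn.ne']⟩
    subst this; simp

lemma quad_expand {ι : Type*} [Fintype ι] [DecidableEq ι] (B : Matrix ι ι ℝ) (hB : Bᵀ = B)
    (p q : ι → ℝ) :
    (p + q) ⬝ᵥ B.mulVec (p + q) =
      p ⬝ᵥ B.mulVec p + 2 * (B.mulVec p ⬝ᵥ q) + q ⬝ᵥ B.mulVec q := by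
  have h : p ⬝ᵥ B.mulVec q = B.mulVec p ⬝ᵥ q := by
    rw [dotProduct_mulVec, ← mulVec_transpose, hB]
  rw [mulVec_add, dotProduct_add, add_dotProduct, add_dotProduct, h,
    dotProduct_comm q (B.mulVec p)]
  ring

lemma subM_inv_mul {ι : Type*} [Fintype ι] [DecidableEq ι] (A : Matrix ι ι ℝ) (hA : A.PosDef)
    (I : Finset ι) : subM A⁻¹ Iᶜ Iᶜ * schurC A I = 1 := by
  have hII : (subM A I I).PosDef :=
    hA.submatrix (e := (Subtype.val : ↥I → ι)) Subtype.val_injective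
  have hu : IsUnit (subM A I I).det := hII.det_pos.ne'.isUnit
  have hAu : IsUnit A.det := hA.det_pos.ne'.isUnit
  have hBA : A⁻¹ * A = 1 := nonsing_inv_mul A hAu
  have hblock : ∀ (J : Finset ι), subM A⁻¹ Iᶜ I * subM A I J + subM A⁻¹ Iᶜ Iᶜ * subM A Iᶜ J
      = Matrix.of fun (i : ↥Iᶜ) (j : ↥J) => (1 : Matrix ι ι ℝ) (i : ι) (j : ι) := by
    intro J
    ext i j
    rw [← hBA]
    simp only [Matrix.of_apply, Matrix.add_apply, Matrix.mul_apply, subM]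
    rw [Finset.sum_coe_sort I (fun k => A⁻¹ i k * A k j),
      Finset.sum_coe_sort Iᶜ (fun k => A⁻¹ i k * A k j), Finset.sum_add_sum_compl]
  have h1 : subM A⁻¹ Iᶜ I * subM A I I = - (subM A⁻¹ Iᶜ Iᶜ * subM A Iᶜ I) := by
    rw [eq_neg_iff_add_eq_zero, hblock I]
    ext i j
    have : (i : ι) ≠ j := fun h => by
      have := i.2
      rw [Finset.mem_compl, h] at this
      exact this j.2
    simp [this]
  have h2 : subM A⁻¹ Iᶜ I * subM A I Iᶜ + subM A⁻¹ Iᶜ Iᶜ * subM A Iᶜ Iᶜ = 1 := by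
    rw [hblock Iᶜ]
    ext i j
    by_cases h : i = j
    · subst h; simp
    · have h' : (i : ι) ≠ j := fun e => h (Subtype.ext e)
      simp [h, h']
  have h3 : subM A⁻¹ Iᶜ I = - (subM A⁻¹ Iᶜ Iᶜ * subM A Iᶜ I) * (subM A I I)⁻¹ := by
    rw [← h1, Matrix.mul_nonsing_inv_cancel_right _ _ hu]
  rw [h3] at h2
  unfold schurC
  rw [Matrix.mul_sub, ← h2]
  simp only [Matrix.mul_assoc, Matrix.neg_mul]
  abel

lemma schurC_inv {ι : Type*} [Fintype ι] [DecidableEq ι] (A : Matrix ι ι ℝ) (hA : A.PosDef)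
    (I : Finset ι) : (schurC A I)⁻¹ = subM A⁻¹ Iᶜ Iᶜ :=
  Matrix.inv_eq_left_inv (subM_inv_mul A hA I)

lemma subM_inv_posDef {ι : Type*} [Fintype ι] [DecidableEq ι] (A : Matrix ι ι ℝ) (hA : A.PosDef)
    (I : Finset ι) : (subM A⁻¹ I I).PosDef :=
  hA.inv.submatrix (e := (Subtype.val : ↥I → ι)) Subtype.val_injective

lemma schurC_det_pos {ι : Type*} [Fintype ι] [DecidableEq ι] (A : Matrix ι ι ℝ) (hA : A.PosDef)
    (I : Finset ι) : 0 < (schurC A I).det := by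
  have h := congrArg Matrix.det (subM_inv_mul A hA I)
  rw [Matrix.det_mul, Matrix.det_one] at h
  have h1 := (subM_inv_posDef A hA Iᶜ).det_pos
  by_contra h2
  nlinarith [mul_nonneg h1.le (sub_nonneg.mpr (not_lt.mp h2))]

lemma gauss_meas {ι : Type*} [Fintype ι] [DecidableEq ι] (S : Matrix ι ι ℝ) (E : Set (ι → ℝ))
    (hE : MeasurableSet E) :
    (((volume : Measure (ι → ℝ)).withDensity fun x => ENNReal.ofReal (gaussPDF S x)) E).toReal
      = (Real.sqrt ((2 * Real.pi) ^ Fintype.card ι * S.det))⁻¹ *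
        ∫ x, E.indicator (fun x => Real.exp (-(x ⬝ᵥ S⁻¹.mulVec x) / 2)) x := by
  have hcont : Continuous (gaussPDF S) := by
    unfold gaussPDF dotProduct mulVec dotProduct
    fun_prop
  rw [withDensity_apply _ hE, ← integral_eq_lintegral_of_nonneg_ae
    (Eventually.of_forall fun x => by unfold gaussPDF; positivity)
    hcont.aestronglyMeasurable]
  unfold gaussPDF
  rw [integral_const_mul, integral_indicator hE]

lemma integral_subst {ι : Type*} [Fintype ι] [DecidableEq ι] (D b : ι → ℝ) (hD : ∀ i, 0 < D i)
    (f : (ι → ℝ) → ℝ) (hf : Measurable f) :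
    ∫ x, f x = (∏ i, D i) * ∫ z : ι → ℝ, f (b + fun i => D i * z i) := by
  have hp : 0 < ∏ i, D i := Finset.prod_pos fun i _ => hD i
  have hdet : det (diagonal D) ≠ 0 := by rw [det_diagonal]; exact hp.ne'
  have hm := Real.smul_map_diagonal_volume_pi hdet
  have hL : Measurable (toLin' (diagonal D)) :=
    Continuous.measurable (LinearMap.continuous_on_pi _)
  have hf' : Measurable fun x => f (b + x) := hf.comp (measurable_const_add b)
  calc ∫ x, f x = ∫ x, f (b + x) := (integral_add_left_eq_self f b).symm
    _ = ∫ x, f (b + x) ∂(ENNReal.ofReal (abs (det (diagonal D))) •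
          Measure.map (toLin' (diagonal D)) volume) := by rw [hm]
    _ = _ := by
      rw [integral_smul_measure, integral_map hL.aemeasurable
        hf'.aestronglyMeasurable, det_diagonal, abs_of_pos hp,
        ENNReal.toReal_ofReal hp.le, smul_eq_mul]
      congr 1
      refine integral_congr_ae (Eventually.of_forall fun z => ?_)
      simp only [toLin'_apply]
      congr 2
      ext i
      rw [mulVec_diagonal]

lemma integral_pos_open {ι : Type*} [Fintype ι] (f : (ι → ℝ) → ℝ) (hf : ∀ x, 0 ≤ f x)
    (hi : Integrable f) (E : Set (ι → ℝ)) (hE : IsOpen E) (hne : E.Nonempty)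
    (hp : ∀ x ∈ E, f x ≠ 0) : 0 < ∫ x, f x := by
  rw [integral_pos_iff_support_of_nonneg hf hi]
  exact (hE.measure_pos volume hne).trans_le (measure_mono hp)

def Dv {ι : Type*} [DecidableEq ι] (I : Finset ι) (u : ℝ) (i : ι) : ℝ := if i ∈ I then u⁻¹ else 1

def Su {ι : Type*} [DecidableEq ι] (I : Finset ι) (c bt : ι → ℝ) (i0 : ι) (T : Set ℝ) (u : ℝ) :
    Set (ι → ℝ) := {z | z i0 ∈ T ∧ ∀ i, c i * u < bt i * u + Dv I u i * z i}

def Ex {ι : Type*} [Fintype ι] [DecidableEq ι] (B : Matrix ι ι ℝ) (I : Finset ι) (lam : ι → ℝ)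
    (u : ℝ) (z : ι → ℝ) : ℝ :=
  Real.exp (-(lam ⬝ᵥ z) -
    ((fun i => Dv I u i * z i) ⬝ᵥ B.mulVec (fun i => Dv I u i * z i)) / 2)

def kset {ι : Type*} [Fintype ι] [DecidableEq ι] (I N : Finset ι) (i0 : ι) (T : Set ℝ) :
    Set (↥Iᶜ → ℝ) :=
  {y : ↥Iᶜ → ℝ | (∀ j : ↥Iᶜ, (j : ι) = i0 → y j ∈ T) ∧ ∀ j : ↥Iᶜ, (j : ι) ∈ N → 0 < y j}

def kfun {ι : Type*} [Fintype ι] [DecidableEq ι] (B : Matrix ι ι ℝ) (I N : Finset ι) (i0 : ι)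
    (T : Set ℝ) : (↥Iᶜ → ℝ) → ℝ :=
  (kset I N i0 T).indicator fun y => Real.exp (-(y ⬝ᵥ (subM B Iᶜ Iᶜ).mulVec y) / 2)

def hfun {ι : Type*} [Fintype ι] [DecidableEq ι] (I : Finset ι) (lam : ι → ℝ)
    (v : {i // ¬ i ∈ Iᶜ} → ℝ) : ℝ :=
  ∏ i : {i // ¬ i ∈ Iᶜ}, (Set.Ioi (0 : ℝ)).indicator (fun t => Real.exp (-lam i * t)) (v i)

lemma integrable_g {a : ℝ} (ha : 0 < a) :
    Integrable ((Set.Ioi (0 : ℝ)).indicator fun t => Real.exp (-a * t)) := by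
  rw [integrable_indicator_iff measurableSet_Ioi]
  exact integrableOn_exp_mul_Ioi (by linarith) 0

lemma hfun_integral_pos {ι : Type*} [Fintype ι] [DecidableEq ι] (I : Finset ι) (lam : ι → ℝ)
    (hlam : ∀ i ∈ I, 0 < lam i) : 0 < ∫ v, hfun I lam v := by
  have hl : ∀ i : {i // ¬ i ∈ Iᶜ}, 0 < lam i := fun i => hlam i (by simpa using i.2)
  have hnn : ∀ (i : {i // ¬ i ∈ Iᶜ}) (t : ℝ), 0 ≤ (Set.Ioi (0 : ℝ)).indicator
      (fun t => Real.exp (-lam i * t)) t := fun i t =>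
    Set.indicator_nonneg (fun _ _ => (Real.exp_pos _).le) t
  refine integral_pos_open _ (fun v => Finset.prod_nonneg fun i _ => hnn i _)
    (Integrable.fintype_prod (f := fun (i : {i // ¬ i ∈ Iᶜ}) => (Set.Ioi (0 : ℝ)).indicator
      (fun t => Real.exp (-lam i * t))) fun i => integrable_g (hl i))
    {v | ∀ i, 0 < v i} ?_ ⟨fun _ => 1, fun _ => one_pos⟩ ?_
  · rw [Set.ofPred_forall]
    exact isOpen_iInter_of_finite fun i => isOpen_lt continuous_const (continuous_apply i)
  · intro v hv
    refine Finset.prod_ne_zero_iff.mpr fun i _ => ?_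
    rw [Set.indicator_of_mem (show v i ∈ Set.Ioi (0 : ℝ) from hv i)]
    exact (Real.exp_pos _).ne'

lemma cont_quad {ι : Type*} [Fintype ι] (B : Matrix ι ι ℝ) :
    Continuous fun x : ι → ℝ => x ⬝ᵥ B.mulVec x := by
  unfold dotProduct mulVec dotProduct
  fun_prop

lemma gauss_integrable {ι : Type*} [Fintype ι] [DecidableEq ι] (B : Matrix ι ι ℝ)
    (hB : B.PosDef) : Integrable fun y : ι → ℝ => Real.exp (-(y ⬝ᵥ B.mulVec y) / 2) := by
  obtain ⟨m, hm, hmb⟩ := pd_lower B hB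
  have hint : Integrable fun y : ι → ℝ => ∏ i, Real.exp (-(m / 2) * y i ^ 2) :=
    Integrable.fintype_prod (f := fun _ t => Real.exp (-(m / 2) * t ^ 2)) fun i =>
      integrable_exp_neg_mul_sq (by positivity)
  refine hint.mono' ?_ (Eventually.of_forall fun y => ?_)
  · have := cont_quad B
    exact Continuous.aestronglyMeasurable (by fun_prop)
  · rw [Real.norm_eq_abs, abs_of_pos (Real.exp_pos _), ← Real.exp_sum, Real.exp_le_exp,
      ← Finset.mul_sum]
    linarith [hmb y]

lemma kset_meas {ι : Type*} [Fintype ι] [DecidableEq ι] (I N : Finset ι) (i0 : ι) (T : Set ℝ)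
    (hT : MeasurableSet T) : MeasurableSet (kset I N i0 T) := by
  have h : kset I N i0 T = {y : ↥Iᶜ → ℝ | ∀ j : ↥Iᶜ, (j : ι) = i0 → y j ∈ T} ∩
      {y : ↥Iᶜ → ℝ | ∀ j : ↥Iᶜ, (j : ι) ∈ N → 0 < y j} := by
    ext y; rfl
  rw [h]
  refine MeasurableSet.inter ?_ ?_
  · rw [Set.ofPred_forall]
    refine MeasurableSet.iInter fun j => ?_
    rw [Set.ofPred_forall]
    exact MeasurableSet.iInter fun _ => measurable_pi_apply j hT
  · rw [Set.ofPred_forall]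
    refine MeasurableSet.iInter fun j => ?_
    rw [Set.ofPred_forall]
    exact MeasurableSet.iInter fun _ => measurable_pi_apply j measurableSet_Ioi

lemma kfun_integral_pos {ι : Type*} [Fintype ι] [DecidableEq ι] (B : Matrix ι ι ℝ)
    (I N : Finset ι) (i0 : ι) (hB : (subM B Iᶜ Iᶜ).PosDef) :
    0 < ∫ y, kfun B I N i0 Set.univ y := by
  refine integral_pos_open _ (fun y => Set.indicator_nonneg (fun _ _ => (Real.exp_pos _).le) y)
    ((gauss_integrable _ hB).indicator (kset_meas I N i0 _ MeasurableSet.univ))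
    {y | ∀ j, 0 < y j} ?_ ⟨fun _ => 1, fun _ => one_pos⟩ ?_
  · rw [Set.ofPred_forall]
    exact isOpen_iInter_of_finite fun i => isOpen_lt continuous_const (continuous_apply i)
  · intro y hy
    rw [kfun, Set.indicator_of_mem]
    · exact (Real.exp_pos _).ne'
    · exact ⟨fun _ _ => trivial, fun j _ => hy j⟩

lemma Su_meas {ι : Type*} [Fintype ι] [DecidableEq ι] (I : Finset ι) (c bt : ι → ℝ) (i0 : ι)
    (T : Set ℝ) (hT : MeasurableSet T) (u : ℝ) : MeasurableSet (Su I c bt i0 T u) := by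
  have h : Su I c bt i0 T u = {z : ι → ℝ | z i0 ∈ T} ∩
      {z : ι → ℝ | ∀ i, c i * u < bt i * u + Dv I u i * z i} := by
    ext y; rfl
  rw [h]
  refine MeasurableSet.inter (measurable_pi_apply i0 hT) ?_
  rw [Set.ofPred_forall]
  refine MeasurableSet.iInter fun i => ?_
  exact measurableSet_lt measurable_const (by fun_prop)

lemma Ex_cont {ι : Type*} [Fintype ι] [DecidableEq ι] (B : Matrix ι ι ℝ) (I : Finset ι)
    (lam : ι → ℝ) (u : ℝ) : Continuous (Ex B I lam u) := by
  unfold Ex dotProduct mulVec dotProduct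
  fun_prop

lemma mem_Su_iff {ι : Type*} [Fintype ι] [DecidableEq ι] (I L : Finset ι) (c bt : ι → ℝ) (i0 : ι)
    (hi0 : i0 ∉ I) (T : Set ℝ) (hcb : ∀ i, c i ≤ bt i) (hL : ∀ i, i ∈ L ↔ bt i = c i)
    (hIL : I ⊆ L) (z : ι → ℝ) :
    ∀ᶠ u in atTop, (z ∈ Su I c bt i0 T u ↔
      ((∀ i ∈ I, 0 < z i) ∧ (fun j : ↥Iᶜ => z j) ∈ kset I (L \ I) i0 T)) := by
  have h1 : ∀ i, ∀ᶠ u : ℝ in atTop, i ∉ L → c i * u < bt i * u + Dv I u i * z i := by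
    intro i
    by_cases hi : i ∈ L
    · exact Eventually.of_forall fun u h => absurd hi h
    have hlt : 0 < bt i - c i := by
      rcases (hcb i).lt_or_eq with h | h
      · linarith
      · exact absurd ((hL i).mpr h.symm) hi
    have : Tendsto (fun u : ℝ => (bt i - c i) * u) atTop atTop :=
      tendsto_id.const_mul_atTop hlt
    filter_upwards [this.eventually_gt_atTop (-z i)] with u hu _
    have hiI : i ∉ I := fun h => hi (hIL h)
    simp only [Dv, hiI, if_false]
    linarith
  filter_upwards [eventually_all.mpr h1, eventually_gt_atTop 0] with u hu hu0
  constructor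
  · rintro ⟨hz0, hz⟩
    refine ⟨fun i hi => ?_, ?_, ?_⟩
    · have := hz i
      rw [(hL i).mp (hIL hi)] at this
      simp only [Dv, hi, if_true] at this
      have h2 : 0 < u⁻¹ * z i := by linarith
      exact (pos_iff_pos_of_mul_pos h2).mp (inv_pos.mpr hu0)
    · rintro j hj
      simp only [hj]; exact hz0
    · intro j hj
      have hjL := Finset.mem_sdiff.mp hj
      have := hz j
      rw [(hL j).mp hjL.1] at this
      simp only [Dv, hjL.2, if_false] at this
      linarith
  · rintro ⟨hzI, hzT, hzN⟩
    refine ⟨hzT ⟨i0, by simpa using hi0⟩ rfl, fun i => ?_⟩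
    by_cases hi : i ∈ I
    · rw [(hL i).mp (hIL hi)]
      simp only [Dv, hi, if_true]
      have := mul_pos (inv_pos.mpr hu0) (hzI i hi)
      linarith
    by_cases hiL : i ∈ L
    · rw [(hL i).mp hiL]
      have := hzN ⟨i, by simpa using hi⟩ (Finset.mem_sdiff.mpr ⟨hiL, hi⟩)
      simp only [Dv, hi, if_false]
      simp only at this
      linarith
    · exact hu i hiL

lemma quad_restrict {ι : Type*} [Fintype ι] [DecidableEq ι] (B : Matrix ι ι ℝ) (I : Finset ι)
    (z : ι → ℝ) :
    (fun i => (if i ∈ I then 0 else 1) * z i) ⬝ᵥ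
      B.mulVec (fun i => (if i ∈ I then 0 else 1) * z i) =
    (fun j : ↥Iᶜ => z j) ⬝ᵥ (subM B Iᶜ Iᶜ).mulVec (fun j : ↥Iᶜ => z j) := by
  have hs : ∀ f : ι → ℝ, (∀ i ∈ I, f i = 0) → ∑ i, f i = ∑ j : ↥Iᶜ, f j := by
    intro f hf
    rw [Finset.sum_coe_sort Iᶜ f, ← Finset.sum_add_sum_compl I f, Finset.sum_eq_zero hf, zero_add]
  simp only [dotProduct, mulVec]
  rw [hs _ (fun i hi => by simp [hi])]
  refine Finset.sum_congr rfl fun i _ => ?_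
  rw [hs _ (fun j hj => by simp [hj])]
  have hi := Finset.mem_compl.mp i.2
  simp only [hi, if_false, one_mul]
  congr 1
  refine Finset.sum_congr rfl fun j _ => ?_
  have hj := Finset.mem_compl.mp j.2
  simp [hj, subM]

lemma Ex_tendsto {ι : Type*} [Fintype ι] [DecidableEq ι] (B : Matrix ι ι ℝ) (I : Finset ι)
    (lam : ι → ℝ) (z : ι → ℝ) :
    Tendsto (fun u => Ex B I lam u z) atTop
      (𝓝 (Real.exp (-(lam ⬝ᵥ z)) * Real.exp (-((fun j : ↥Iᶜ => z j) ⬝ᵥ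
        (subM B Iᶜ Iᶜ).mulVec (fun j : ↥Iᶜ => z j)) / 2))) := by
  rw [← Real.exp_add, ← quad_restrict]
  unfold Ex
  have hD : Tendsto (fun (u : ℝ) (i : ι) => Dv I u i * z i) atTop
      (𝓝 (fun i => (if i ∈ I then 0 else 1) * z i)) := by
    rw [tendsto_pi_nhds]
    intro i
    refine Tendsto.mul_const _ ?_
    by_cases hi : i ∈ I
    · simp only [Dv, hi, if_true]
      exact tendsto_inv_atTop_zero
    · simp only [Dv, hi, if_false]
      exact tendsto_const_nhds
  have hq := ((cont_quad B).tendsto _).comp hD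
  refine (Real.continuous_exp.tendsto _).comp ?_
  have := (hq.div_const 2).const_sub (-(lam ⬝ᵥ z))
  rw [neg_div, ← sub_eq_add_neg]
  exact this

lemma limit_integral {ι : Type*} [Fintype ι] [DecidableEq ι] (B : Matrix ι ι ℝ) (hB : B.PosDef)
    (I L : Finset ι) (lam c bt : ι → ℝ) (i0 : ι)
    (hi0 : i0 ∉ I) (T : Set ℝ) (hT : MeasurableSet T)
    (hcb : ∀ i, c i ≤ bt i) (hL : ∀ i, i ∈ L ↔ bt i = c i)
    (hIL : I ⊆ L) (hlam : ∀ i ∈ I, 0 < lam i) (hlam0 : ∀ i, i ∉ I → lam i = 0) :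
    Tendsto (fun u => ∫ z, (Su I c bt i0 T u).indicator (Ex B I lam u) z) atTop
      (𝓝 ((∫ y, kfun B I (L \ I) i0 T y) * ∫ v, hfun I lam v)) := by
  have hmp : MeasurePreserving (MeasurableEquiv.piEquivPiSubtypeProd (fun _ : ι => ℝ)
      (fun i => i ∈ Iᶜ)) volume
      ((volume : Measure (↥Iᶜ → ℝ)).prod (volume : Measure ({i // ¬ i ∈ Iᶜ} → ℝ))) := by
    have h := volume_preserving_piEquivPiSubtypeProd (fun _ : ι => ℝ) (fun i => i ∈ Iᶜ)
    refine ⟨h.measurable, ?_⟩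
    rw [h.map_eq, Measure.volume_eq_prod]
    congr!
  have hfac : (∫ y, kfun B I (L \ I) i0 T y) * ∫ v, hfun I lam v =
      ∫ z : ι → ℝ, kfun B I (L \ I) i0 T (fun j : ↥Iᶜ => z j) *
        hfun I lam (fun j => z j) := by
    rw [← integral_prod_mul]
    exact (hmp.integral_comp' (fun p : (↥Iᶜ → ℝ) × ({i // ¬ i ∈ Iᶜ} → ℝ) =>
      kfun B I (L \ I) i0 T p.1 * hfun I lam p.2)).symm
  rw [hfac]
  obtain ⟨m, hm, hmb⟩ := pd_lower B hB
  let g : ι → ℝ → ℝ := fun i => if i ∈ I then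
    (Set.Ioi (0 : ℝ)).indicator (fun t => Real.exp (-lam i * t)) else
      fun t => Real.exp (-(m / 2) * t ^ 2)
  have hgnn : ∀ i t, 0 ≤ g i t := by
    intro i t
    by_cases hi : i ∈ I
    · simp only [g, hi, if_true]
      exact Set.indicator_nonneg (fun _ _ => (Real.exp_pos _).le) t
    · simp only [g, hi, if_false]
      positivity
  have hgi : Integrable fun z : ι → ℝ => ∏ i, g i (z i) := by
    refine Integrable.fintype_prod fun i => ?_
    by_cases hi : i ∈ I
    · simp only [g, hi, if_true]
      exact integrable_g (hlam i hi)
    · simp only [g, hi, if_false]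
      exact integrable_exp_neg_mul_sq (by positivity)
  refine tendsto_integral_filter_of_dominated_convergence (fun z => ∏ i, g i (z i)) ?_ ?_ hgi ?_
  · refine Eventually.of_forall fun u => ?_
    exact ((Ex_cont B I lam u).measurable.indicator
      (Su_meas I c bt i0 T hT u)).aestronglyMeasurable
  · filter_upwards [eventually_gt_atTop 0] with u hu
    refine Eventually.of_forall fun z => ?_
    by_cases hz : z ∈ Su I c bt i0 T u
    · rw [Set.indicator_of_mem hz, Real.norm_eq_abs, Ex, abs_of_pos (Real.exp_pos _)]
      have hzI : ∀ i ∈ I, 0 < z i := by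
        intro i hi
        have := hz.2 i
        rw [(hL i).mp (hIL hi)] at this
        simp only [Dv, hi, if_true] at this
        have h2 : 0 < u⁻¹ * z i := by linarith
        exact (pos_iff_pos_of_mul_pos h2).mp (inv_pos.mpr hu)
      have hg : ∀ i, g i (z i) =
          Real.exp (if i ∈ I then -lam i * z i else -(m / 2) * z i ^ 2) := by
        intro i
        by_cases hi : i ∈ I
        · simp only [g, hi, if_true]
          exact Set.indicator_of_mem (hzI i hi) _
        · simp only [g, hi, if_false]
      simp only [hg]
      rw [← Real.exp_sum, Real.exp_le_exp]
      have h1 := hmb (fun i => Dv I u i * z i)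
      have h2 : -(lam ⬝ᵥ z) - (m * ∑ i, (Dv I u i * z i) ^ 2) / 2 ≤
          ∑ i, (if i ∈ I then -lam i * z i else -(m / 2) * z i ^ 2) := by
        rw [dotProduct, Finset.mul_sum, Finset.sum_div, ← Finset.sum_neg_distrib,
          ← Finset.sum_sub_distrib]
        refine Finset.sum_le_sum fun i _ => ?_
        by_cases hi : i ∈ I
        · simp only [hi, if_true]
          have : 0 ≤ m * (Dv I u i * z i) ^ 2 / 2 := by positivity
          linarith
        · simp only [hi, if_false, hlam0 i hi, Dv]
          linarith
      linarith
    · rw [Set.indicator_of_notMem hz, norm_zero]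
      exact Finset.prod_nonneg fun i _ => hgnn i _
  · refine Eventually.of_forall fun z => ?_
    have hev := mem_Su_iff I L c bt i0 hi0 T hcb hL hIL z
    by_cases hz : (∀ i ∈ I, 0 < z i) ∧ (fun j : ↥Iᶜ => z j) ∈ kset I (L \ I) i0 T
    · have hlim : kfun B I (L \ I) i0 T (fun j : ↥Iᶜ => z j) * hfun I lam (fun j => z j) =
          Real.exp (-(lam ⬝ᵥ z)) * Real.exp (-((fun j : ↥Iᶜ => z j) ⬝ᵥ
            (subM B Iᶜ Iᶜ).mulVec (fun j : ↥Iᶜ => z j)) / 2) := by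
        rw [kfun, Set.indicator_of_mem hz.2, mul_comm]
        congr 1
        have h1 : hfun I lam (fun j => z j) =
            ∏ i : {i // ¬ i ∈ Iᶜ}, Real.exp (-(lam i * z i)) := by
          refine Finset.prod_congr rfl fun i _ => ?_
          have hi : (i : ι) ∈ I := by simpa using i.2
          rw [Set.indicator_of_mem (show z i ∈ Set.Ioi (0 : ℝ) from hz.1 _ hi), neg_mul]
        rw [h1, ← Real.exp_sum, dotProduct, Finset.sum_neg_distrib]
        congr 2
        rw [← Finset.sum_add_sum_compl I, Finset.sum_eq_zero (s := Iᶜ), add_zero]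
        · symm
          refine Finset.sum_subtype I (p := fun i => ¬ i ∈ Iᶜ) (by simp) (fun i => lam i * z i)
        · intro i hi
          rw [hlam0 i (Finset.mem_compl.mp hi), zero_mul]
      rw [hlim]
      refine (Ex_tendsto B I lam z).congr' ?_
      filter_upwards [hev] with u hu
      rw [Set.indicator_of_mem (hu.mpr hz)]
    · have hlim : kfun B I (L \ I) i0 T (fun j : ↥Iᶜ => z j) * hfun I lam (fun j => z j) = 0 := by
        by_cases hk : (fun j : ↥Iᶜ => z j) ∈ kset I (L \ I) i0 T
        · have : ∃ i ∈ I, ¬ 0 < z i := by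
            by_contra hcon
            push Not at hcon
            exact hz ⟨hcon, hk⟩
          obtain ⟨i, hi, hzi⟩ := this
          rw [hfun, Finset.prod_eq_zero (Finset.mem_univ (⟨i, by simpa using hi⟩ : {i // ¬ i ∈ Iᶜ})),
            mul_zero]
          exact Set.indicator_of_notMem hzi _
        · rw [kfun, Set.indicator_of_notMem hk, zero_mul]
      rw [hlim]
      refine tendsto_const_nhds.congr' ?_
      filter_upwards [hev] with u hu
      rw [Set.indicator_of_notMem (fun h => hz (hu.mp h))]

lemma prob_eq {Ω : Type*} [MeasurableSpace Ω] (P : Measure Ω)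
    {ι : Type*} [Fintype ι] [DecidableEq ι] (A : Matrix ι ι ℝ) (hA : A.PosDef)
    (X : Ω → ι → ℝ) (hX : Measurable X) (hG : IsCenteredGaussianRV P X A)
    (I : Finset ι) (lam c bt : ι → ℝ) (i0 : ι) (hi0 : i0 ∉ I) (T : Set ℝ) (hT : MeasurableSet T)
    (hlam : A⁻¹.mulVec bt = lam) (hlam0 : ∀ i, i ∉ I → lam i = 0) (u : ℝ) (hu : 0 < u) :
    (P {ω | X ω i0 - bt i0 * u ∈ T ∧ ∀ i, c i * u < X ω i}).toReal =
      ((Real.sqrt ((2 * Real.pi) ^ Fintype.card ι * A.det))⁻¹ * (∏ i, Dv I u i) *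
        Real.exp (-(u ^ 2 * (bt ⬝ᵥ lam)) / 2)) *
        ∫ z, (Su I c bt i0 T u).indicator (Ex A⁻¹ I lam u) z := by
  set E : Set (ι → ℝ) := {x | x i0 - bt i0 * u ∈ T ∧ ∀ i, c i * u < x i} with hE
  have hEm : MeasurableSet E := by
    have h : E = {x : ι → ℝ | x i0 - bt i0 * u ∈ T} ∩ {x : ι → ℝ | ∀ i, c i * u < x i} := by
      ext y; rfl
    rw [h]
    refine MeasurableSet.inter ?_ ?_
    · exact (show Measurable fun x : ι → ℝ => x i0 - bt i0 * u by fun_prop) hT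
    · rw [Set.ofPred_forall]
      refine MeasurableSet.iInter fun i => ?_
      exact measurableSet_lt measurable_const (by fun_prop)
  have h1 : P {ω | X ω i0 - bt i0 * u ∈ T ∧ ∀ i, c i * u < X ω i} = Measure.map X P E := by
    rw [Measure.map_apply hX hEm]
    rfl
  have hDpos : ∀ i, 0 < Dv I u i := by
    intro i
    unfold Dv
    split_ifs
    · positivity
    · exact one_pos
  rw [h1, hG, gauss_meas A E hEm]
  have hc := cont_quad A⁻¹
  rw [integral_subst (Dv I u) (u • bt) hDpos _
    (Measurable.indicator (Continuous.measurable (by fun_prop)) hEm)]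
  rw [mul_assoc, mul_assoc, 
    ← integral_const_mul (Real.exp (-(u ^ 2 * (bt ⬝ᵥ lam)) / 2))]
  congr 2
  refine integral_congr_ae (Eventually.of_forall fun z => ?_)
  simp only
  have hmem : ((u • bt + fun i => Dv I u i * z i) ∈ E) ↔ z ∈ Su I c bt i0 T u := by
    have e1 : (u • bt + fun i => Dv I u i * z i) i0 - bt i0 * u = z i0 := by
      simp only [Pi.add_apply, Pi.smul_apply, smul_eq_mul, Dv, hi0, if_false]
      ring
    have e2 : ∀ i, (u • bt + fun i => Dv I u i * z i) i = bt i * u + Dv I u i * z i := by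
      intro i
      simp only [Pi.add_apply, Pi.smul_apply, smul_eq_mul]
      ring
    constructor
    · rintro ⟨ha, hb⟩
      refine ⟨e1 ▸ ha, fun i => ?_⟩
      rw [← e2]; exact hb i
    · rintro ⟨ha, hb⟩
      refine ⟨?_, fun i => ?_⟩
      · rw [e1]; exact ha
      · rw [e2]; exact hb i
  by_cases hz : z ∈ Su I c bt i0 T u
  · rw [Set.indicator_of_mem hz, Set.indicator_of_mem (hmem.mpr hz), Ex, ← Real.exp_add]
    congr 1
    have hsym : (A⁻¹)ᵀ = A⁻¹ := by simpa [Matrix.IsHermitian] using hA.inv.isHermitian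
    rw [quad_expand _ hsym, mulVec_smul, hlam]
    have h2 : (u • lam) ⬝ᵥ (fun i => Dv I u i * z i) = lam ⬝ᵥ z := by
      refine Finset.sum_congr rfl fun i _ => ?_
      by_cases hi : i ∈ I
      · simp only [Pi.smul_apply, smul_eq_mul, Dv, hi, if_true]
        field_simp
      · simp [hlam0 i hi]
    rw [h2, smul_dotProduct, dotProduct_smul, smul_eq_mul, smul_eq_mul]
    ring
  · rw [Set.indicator_of_notMem hz, Set.indicator_of_notMem (fun h => hz (hmem.mp h)), mul_zero]

lemma Gbar_eq {ι : Type*} [Fintype ι] [DecidableEq ι] (A : Matrix ι ι ℝ) (hA : A.PosDef)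
    (I N : Finset ι) (i0 : ι) (x : ℝ) :
    Gbar A I N i0 x = (∫ y, kfun A⁻¹ I N i0 (Set.Ioi x) y) / ∫ y, kfun A⁻¹ I N i0 Set.univ y := by
  have e1 : {y : ↥Iᶜ → ℝ | (∀ j : ↥Iᶜ, (j : ι) = i0 → x < y j) ∧
      ∀ j : ↥Iᶜ, (j : ι) ∈ N → 0 < y j} = kset I N i0 (Set.Ioi x) := by
    ext y; rfl
  have e2 : {y : ↥Iᶜ → ℝ | ∀ j : ↥Iᶜ, (j : ι) ∈ N → 0 < y j} = kset I N i0 Set.univ := by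
    ext y; simp [kset]
  have hdet := schurC_det_pos A hA I
  have hK : (Real.sqrt ((2 * Real.pi) ^ Fintype.card ↥Iᶜ * (schurC A I).det))⁻¹ ≠ 0 := by
    have := Real.pi_pos
    positivity
  unfold Gbar condNu
  rw [e1, e2, gauss_meas _ _ (kset_meas I N i0 _ measurableSet_Ioi),
    gauss_meas _ _ (kset_meas I N i0 _ MeasurableSet.univ), mul_div_mul_left _ _ hK,
    schurC_inv A hA I]
  rfl

lemma lam_spec {ι : Type*} [Fintype ι] [DecidableEq ι] (A : Matrix ι ι ℝ) (hA : A.PosDef)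
    (c bt : ι → ℝ) (I : Finset ι) (hI : IsQPIndex A c bt I) :
    ∃ lam : ι → ℝ, A⁻¹.mulVec bt = lam ∧ (∀ i ∈ I, 0 < lam i) ∧ ∀ i, i ∉ I → lam i = 0 := by
  obtain ⟨-, h1, h2, h3⟩ := hI
  have hII : (subM A I I).PosDef :=
    hA.submatrix (e := (Subtype.val : ↥I → ι)) Subtype.val_injective
  have hu : IsUnit (subM A I I).det := hII.det_pos.ne'.isUnit
  have hAu : IsUnit A.det := hA.det_pos.ne'.isUnit
  set w := (subM A I I)⁻¹.mulVec (subV c I) with hw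
  let lam : ι → ℝ := fun i => if h : i ∈ I then w ⟨i, h⟩ else 0
  have hsum : ∀ j, A.mulVec lam j = ∑ i : ↥I, A j i * w i := by
    intro j
    rw [mulVec, dotProduct, ← Finset.sum_add_sum_compl I, Finset.sum_eq_zero (s := Iᶜ), add_zero,
      ← Finset.sum_coe_sort I]
    · refine Finset.sum_congr rfl fun i _ => ?_
      simp [lam]
    · intro i hi
      simp [lam, Finset.mem_compl.mp hi]
  have hAl : A.mulVec lam = bt := by
    ext j
    rw [hsum]
    by_cases hj : j ∈ I
    · have : (subM A I I).mulVec w = subV c I := by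
        rw [hw, mulVec_mulVec, mul_nonsing_inv _ hu, one_mulVec]
      rw [h1 j hj]
      exact congrFun this ⟨j, hj⟩
    · rw [h3 j hj]
      rfl
  refine ⟨lam, ?_, ?_, ?_⟩
  · rw [← hAl, mulVec_mulVec, nonsing_inv_mul _ hAu, one_mulVec]
  · intro i hi
    simpa [lam, hi] using h2 ⟨i, hi⟩
  · intro i hi
    simp [lam, hi]

/-- Theorem 2.4 (conditional limit): if `1 ∈ L^c`, then
`c̃_1 = Σ_{1,I}(Σ_II)⁻¹c_I > c_1` and the conditional law of `X_1 - c̃_1 u` given `X > c u`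
converges in distribution, as `u → ∞`, to `Y` with survival function
`Ḡ(x) = P(X_1 > x, X_{N*} > 0 | X_I = 0)/P(X_{N*} > 0 | X_I = 0)`, `N* = L \ I`
(so that `Ḡ(x) = P(X_1 > x | X_I = 0)` when `L = I`). -/
theorem mcte_multivariate_gaussian_conditional_limit
    {Ω : Type*} [MeasurableSpace Ω] (P : Measure Ω) [IsProbabilityMeasure P]
    {d : ℕ} [NeZero d] (A : Matrix (Fin d) (Fin d) ℝ) (hA : A.PosDef)
    (hcorr : ∀ i, A i i = 1)
    (X : Ω → Fin d → ℝ) (hX : Measurable X) (hG : IsCenteredGaussianRV P X A)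
    (c : Fin d → ℝ) (hc : ∃ i, 0 < c i)
    (bt : Fin d → ℝ) (I L : Finset (Fin d))
    (hsol : IsQPSol A c bt) (hI : IsQPIndex A c bt I) (hL : ∀ i, i ∈ L ↔ bt i = c i)
    (h1Lc : (0 : Fin d) ∉ L) :
    c 0 < rowDot A c I 0 ∧
    ∀ x : ℝ,
      Tendsto (fun u =>
          (P {ω | x + rowDot A c I 0 * u < X ω 0 ∧ ∀ i, c i * u < X ω i}).toReal /
            (P {ω | ∀ i, c i * u < X ω i}).toReal) atTop
        (𝓝 (Gbar A I (L \ I) 0 x)) := by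
  have hIL : I ⊆ L := fun i hi => (hL i).mpr (hI.2.1 i hi)
  have h0I : (0 : Fin d) ∉ I := fun h => h1Lc (hIL h)
  have hbt0 : rowDot A c I 0 = bt 0 := (hI.2.2.2 0 h0I).symm
  rw [hbt0]
  refine ⟨lt_of_le_of_ne (hsol.1 0) fun h => h1Lc ((hL 0).mpr h.symm), fun x => ?_⟩
  obtain ⟨lam, hl, hlp, hl0⟩ := lam_spec A hA c bt I hI
  have hlim := fun (T : Set ℝ) (hT : MeasurableSet T) =>
    limit_integral A⁻¹ hA.inv I L lam c bt 0 h0I T hT hsol.1 hL hIL hlp hl0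
  have hH := hfun_integral_pos I lam hlp
  have hk := kfun_integral_pos A⁻¹ I (L \ I) 0 (subM_inv_posDef A hA Iᶜ)
  have hdiv := (hlim (Set.Ioi x) measurableSet_Ioi).div (hlim Set.univ MeasurableSet.univ)
    (mul_pos hk hH).ne'
  rw [mul_div_mul_right _ _ hH.ne', ← Gbar_eq A hA] at hdiv
  refine hdiv.congr' ?_
  filter_upwards [eventually_gt_atTop 0] with u hu
  have e1 : {ω | x + bt 0 * u < X ω 0 ∧ ∀ i, c i * u < X ω i} =
      {ω | X ω 0 - bt 0 * u ∈ Set.Ioi x ∧ ∀ i, c i * u < X ω i} := by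
    ext ω
    simp [lt_sub_iff_add_lt]
  have e2 : {ω | ∀ i, c i * u < X ω i} =
      {ω | X ω 0 - bt 0 * u ∈ Set.univ ∧ ∀ i, c i * u < X ω i} := by
    ext ω
    simp
  rw [e1, e2, prob_eq P A hA X hX hG I lam c bt 0 h0I _ measurableSet_Ioi hl hl0 u hu,
    prob_eq P A hA X hX hG I lam c bt 0 h0I _ MeasurableSet.univ hl hl0 u hu, mul_div_mul_left]
  · rfl
  have hdet := hA.det_pos
  have hpi := Real.pi_pos
  have hD : 0 < ∏ i, Dv I u i := by
    refine Finset.prod_pos fun i _ => ?_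
    unfold Dv
    split_ifs
    · positivity
    · exact one_pos
  positivity
end
end

section
/- Let X be a centered d-dimensional Gaussian random vector with non-singular correlation matrix \Sigma and let c \in R^d have at least one positive component, with I and L the index sets determined by \Pi_\Sigma(c). Assume 1 \in L^c and set \tilde c_1 = \Sigma_{1,I}(\Sigma_{II})^{-1} c_I. Then the multivariate conditional tail expectation satisfies M(c,u) - \tilde c_1 u \to E[Y] as u \to \infty, where Y is the distributional limit of (X_1 - \tilde c_1 u) conditional on X > c u, having survival function \bar G(x) = P(X_1 > x | X_I = 0_I) if L = I, and otherwise, with N* = L \setminus I, \bar G(x) = P(X_1 > x, X_{N*} > 0_{N*} | X_I = 0_I) / P(X_{N*} > 0_{N*} | X_I = 0_I). -/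
open MeasureTheory ProbabilityTheory Filter Matrix
open scoped Topology ENNReal

noncomputable section

/-- scaling vector -/
def scv {d : ℕ} (I : Finset (Fin d)) (t : ℝ) (i : Fin d) : ℝ := if i ∈ I then t else 1

/-- kernel -/
def ker0 {d : ℕ} (B : Matrix (Fin d) (Fin d) ℝ) (w : Fin d → ℝ) (I : Finset (Fin d))
    (t : ℝ) (y : Fin d → ℝ) : ℝ :=
  Real.exp (-(w ⬝ᵥ y) - ((fun i => scv I t i * y i) ⬝ᵥ B *ᵥ (fun i => scv I t i * y i)) / 2)

/-- one-dimensional bounds -/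
def gbd {d : ℕ} (w : Fin d → ℝ) (I : Finset (Fin d)) (i : Fin d) (x : ℝ) : ℝ :=
  if i ∈ I then (Set.Ioi 0).indicator (fun x => Real.exp (-(w i) * x)) x
  else (1 + |x|) * Real.exp (-(1 / (2 * (d : ℝ))) * x ^ 2)

/-- set of positivity, before the limit -/
def setU {d : ℕ} (e : Fin d → ℝ) (I : Finset (Fin d)) (u : ℝ) : Set (Fin d → ℝ) :=
  {y | ∀ i, e i * u < scv I u⁻¹ i * y i}

lemma gbd_integrable {d : ℕ} (hd : 0 < d) (w : Fin d → ℝ) (I : Finset (Fin d))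
    (hw : ∀ i ∈ I, 0 < w i) :
    Integrable (fun y : Fin d → ℝ => ∏ i, gbd w I i (y i)) := by
  apply Integrable.fintype_prod (f := fun i => gbd w I i)
  intro i
  unfold gbd
  by_cases hi : i ∈ I
  · simp only [hi, if_true]
    exact (exp_neg_integrableOn_Ioi 0 (hw i hi)).integrable_indicator measurableSet_Ioi
  · simp only [hi, if_false]
    have hb : (0:ℝ) < 1 / (2 * (d : ℝ)) := by positivity
    have h1 := integrable_exp_neg_mul_sq hb
    have h2 := (integrable_mul_exp_neg_mul_sq hb).abs
    refine (h1.add h2).congr (ae_of_all _ fun x => ?_)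
    simp [abs_mul, add_mul]

lemma ker_bound {d : ℕ} [NeZero d] (B : Matrix (Fin d) (Fin d) ℝ) (w : Fin d → ℝ)
    (I : Finset (Fin d)) (hw0 : ∀ i, i ∉ I → w i = 0) (h0 : (0 : Fin d) ∉ I)
    (hB : ∀ (y : Fin d → ℝ) j, y j ^ 2 ≤ y ⬝ᵥ B *ᵥ y) (t : ℝ) (y : Fin d → ℝ)
    (hy : ∀ i ∈ I, 0 < y i) :
    (1 + |y 0|) * ker0 B w I t y ≤ ∏ i, gbd w I i (y i) := by
  have hd : (0:ℝ) < d := by exact_mod_cast Nat.pos_of_ne_zero (NeZero.ne d)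
  have e1 : ∀ i, gbd w I i (y i) = (if i ∈ I then 1 else 1 + |y i|) *
      Real.exp (if i ∈ I then -(w i) * y i else -(1 / (2 * (d : ℝ))) * y i ^ 2) := by
    intro i
    unfold gbd
    split_ifs with h
    · simp [Set.indicator, hy i h]
    · rfl
  simp_rw [e1]
  rw [Finset.prod_mul_distrib, ← Real.exp_sum]
  have hge1 : ∀ i, (1:ℝ) ≤ if i ∈ I then 1 else 1 + |y i| := by
    intro i; split_ifs <;> simp
  have hprod : 1 + |y 0| ≤ ∏ i, if i ∈ I then (1:ℝ) else 1 + |y i| := by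
    rw [← Finset.mul_prod_erase _ _ (Finset.mem_univ (0 : Fin d))]
    simp only [h0, if_false]
    refine le_mul_of_one_le_right (by positivity) ?_
    calc (1:ℝ) = ∏ i ∈ Finset.univ.erase (0 : Fin d), (1:ℝ) := by simp
      _ ≤ _ := Finset.prod_le_prod (by simp) (fun i _ => hge1 i)
  have hexp : ker0 B w I t y ≤ Real.exp (∑ i, if i ∈ I then -(w i) * y i else
      -(1 / (2 * (d : ℝ))) * y i ^ 2) := by
    unfold ker0
    apply Real.exp_le_exp.2
    set v : Fin d → ℝ := fun i => scv I t i * y i with hv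
    have hsum : ∑ i, (if i ∈ I then 0 else y i ^ 2) ≤ d * (v ⬝ᵥ B *ᵥ v) := by
      calc ∑ i, (if i ∈ I then 0 else y i ^ 2) ≤ ∑ i : Fin d, v ⬝ᵥ B *ᵥ v := by
            apply Finset.sum_le_sum
            intro i _
            refine le_trans ?_ (hB v i)
            simp only [hv, scv]
            split_ifs
            · positivity
            · simp
        _ = _ := by simp
    have : (∑ i, if i ∈ I then -(w i) * y i else -(1 / (2 * (d : ℝ))) * y i ^ 2)
        = -(w ⬝ᵥ y) - (1 / (2 * (d : ℝ))) * ∑ i, (if i ∈ I then 0 else y i ^ 2) := by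
      rw [dotProduct, ← Finset.sum_neg_distrib, Finset.mul_sum, ← Finset.sum_sub_distrib]
      apply Finset.sum_congr rfl
      intro i _
      split_ifs with h
      · ring
      · rw [hw0 i h]; ring
    rw [this]
    have : (1 / (2 * (d : ℝ))) * ∑ i, (if i ∈ I then 0 else y i ^ 2) ≤
        (1 / (2 * (d : ℝ))) * (d * (v ⬝ᵥ B *ᵥ v)) := by gcongr
    have h3 : (1 / (2 * (d : ℝ))) * (d * (v ⬝ᵥ B *ᵥ v)) = (v ⬝ᵥ B *ᵥ v) / 2 := by
      field_simp
    linarith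
  exact mul_le_mul hprod hexp (by unfold ker0; positivity) (by positivity)

lemma ker0_continuous {d : ℕ} (B : Matrix (Fin d) (Fin d) ℝ) (w : Fin d → ℝ)
    (I : Finset (Fin d)) : Continuous (fun p : ℝ × (Fin d → ℝ) => ker0 B w I p.1 p.2) := by
  have : ∀ i, Continuous (fun p : ℝ × (Fin d → ℝ) => scv I p.1 i * p.2 i) := by
    intro i
    unfold scv
    split_ifs <;> fun_prop
  unfold ker0
  simp only [dotProduct, mulVec]
  fun_prop

lemma ker0_continuous' {d : ℕ} (B : Matrix (Fin d) (Fin d) ℝ) (w : Fin d → ℝ)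
    (I : Finset (Fin d)) (t : ℝ) : Continuous (ker0 B w I t) :=
  (ker0_continuous B w I).comp (by fun_prop : Continuous fun y : Fin d → ℝ => (t, y))

lemma setU_meas {d : ℕ} (e : Fin d → ℝ) (I : Finset (Fin d)) (u : ℝ) :
    MeasurableSet (setU e I u) := by
  unfold setU
  rw [Set.ofPred_forall]
  exact MeasurableSet.iInter fun i => measurableSet_lt (by fun_prop) (by fun_prop)

lemma posL_meas {d : ℕ} (L : Finset (Fin d)) :
    MeasurableSet {y : Fin d → ℝ | ∀ i ∈ L, 0 < y i} := by
  simp only [Set.ofPred_forall]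
  exact MeasurableSet.iInter fun i => MeasurableSet.iInter fun _ =>
    measurableSet_lt (by fun_prop) (by fun_prop)

lemma setU_pos {d : ℕ} (e : Fin d → ℝ) (I : Finset (Fin d)) (heI : ∀ i ∈ I, e i = 0)
    {u : ℝ} (hu : 0 < u) {y : Fin d → ℝ} (hy : y ∈ setU e I u) : ∀ i ∈ I, 0 < y i := by
  intro i hi
  have := hy i
  simp only [heI i hi, scv, hi, if_true, zero_mul] at this
  exact (mul_pos_iff_of_pos_left (inv_pos.2 hu)).1 this

lemma ind_bound {d : ℕ} [NeZero d] (B : Matrix (Fin d) (Fin d) ℝ) (w : Fin d → ℝ)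
    (I : Finset (Fin d)) (hw0 : ∀ i, i ∉ I → w i = 0) (h0 : (0 : Fin d) ∉ I)
    (hB : ∀ (y : Fin d → ℝ) j, y j ^ 2 ≤ y ⬝ᵥ B *ᵥ y)
    (f : (Fin d → ℝ) → ℝ) (hfb : ∀ y, |f y| ≤ 1 + |y 0|) (E : Set (Fin d → ℝ))
    (hE : ∀ y ∈ E, ∀ i ∈ I, 0 < y i) (t : ℝ) (y : Fin d → ℝ) :
    ‖E.indicator (fun y => f y * ker0 B w I t y) y‖ ≤ ∏ i, gbd w I i (y i) := by
  have hker : ∀ y, 0 ≤ ker0 B w I t y := fun y => (Real.exp_pos _).le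
  by_cases hy : y ∈ E
  · rw [Set.indicator_of_mem hy, Real.norm_eq_abs, abs_mul, abs_of_nonneg (hker y)]
    exact (mul_le_mul_of_nonneg_right (hfb y) (hker y)).trans
      (ker_bound B w I hw0 h0 hB t y (hE y hy))
  · rw [Set.indicator_of_notMem hy, norm_zero]
    apply Finset.prod_nonneg
    intro i _
    unfold gbd
    split_ifs
    · exact Set.indicator_nonneg (fun _ _ => (Real.exp_pos _).le) _
    · positivity

lemma ind_integrable {d : ℕ} [NeZero d] (B : Matrix (Fin d) (Fin d) ℝ) (w : Fin d → ℝ)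
    (I : Finset (Fin d)) (hw : ∀ i ∈ I, 0 < w i)
    (hw0 : ∀ i, i ∉ I → w i = 0) (h0 : (0 : Fin d) ∉ I)
    (hB : ∀ (y : Fin d → ℝ) j, y j ^ 2 ≤ y ⬝ᵥ B *ᵥ y)
    (f : (Fin d → ℝ) → ℝ) (hf : Measurable f) (hfb : ∀ y, |f y| ≤ 1 + |y 0|)
    (E : Set (Fin d → ℝ)) (hEm : MeasurableSet E)
    (hE : ∀ y ∈ E, ∀ i ∈ I, 0 < y i) (t : ℝ) :
    Integrable (E.indicator (fun y => f y * ker0 B w I t y)) := by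
  refine (gbd_integrable (Nat.pos_of_ne_zero (NeZero.ne d)) w I hw).mono' ?_
    (ae_of_all _ (ind_bound B w I hw0 h0 hB f hfb E hE t))
  exact ((hf.mul (ker0_continuous' B w I t).measurable).indicator hEm).aestronglyMeasurable

lemma key_tendsto {d : ℕ} [NeZero d] (B : Matrix (Fin d) (Fin d) ℝ) (w e : Fin d → ℝ)
    (I L : Finset (Fin d)) (hw : ∀ i ∈ I, 0 < w i)
    (hw0 : ∀ i, i ∉ I → w i = 0) (h0 : (0 : Fin d) ∉ I)
    (hB : ∀ (y : Fin d → ℝ) j, y j ^ 2 ≤ y ⬝ᵥ B *ᵥ y) (hIL : I ⊆ L)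
    (heL : ∀ i ∈ L, e i = 0) (heLc : ∀ i, i ∉ L → e i < 0)
    (f : (Fin d → ℝ) → ℝ) (hf : Measurable f) (hfb : ∀ y, |f y| ≤ 1 + |y 0|) :
    Tendsto (fun u : ℝ => ∫ y, (setU e I u).indicator (fun y => f y * ker0 B w I u⁻¹ y) y) atTop
      (𝓝 (∫ y, {y : Fin d → ℝ | ∀ i ∈ L, 0 < y i}.indicator
        (fun y => f y * ker0 B w I 0 y) y)) := by
  refine tendsto_integral_filter_of_dominated_convergence
    (fun y => ∏ i, gbd w I i (y i)) ?_ ?_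
    (gbd_integrable (Nat.pos_of_ne_zero (NeZero.ne d)) w I hw) ?_
  · exact Eventually.of_forall fun u => ((hf.mul
      (ker0_continuous' B w I _).measurable).indicator (setU_meas e I u)).aestronglyMeasurable
  · filter_upwards [eventually_gt_atTop 0] with u hu
    exact ae_of_all _ (ind_bound B w I hw0 h0 hB f hfb _
      (fun y hy => setU_pos e I (fun i hi => heL i (hIL hi)) hu hy) _)
  · refine ae_of_all _ fun y => ?_
    have hk : Tendsto (fun u : ℝ => f y * ker0 B w I u⁻¹ y) atTop (𝓝 (f y * ker0 B w I 0 y)) := by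
      apply Tendsto.const_mul
      have hc : Continuous (fun t => ker0 B w I t y) :=
        (ker0_continuous B w I).comp (by fun_prop : Continuous fun t : ℝ => (t, y))
      exact (hc.tendsto 0).comp tendsto_inv_atTop_zero
    by_cases hy : ∀ i ∈ L, 0 < y i
    · rw [Set.indicator_of_mem (by exact hy)]
      refine hk.congr' ?_
      have hall : ∀ᶠ u : ℝ in atTop, ∀ i, e i * u < scv I u⁻¹ i * y i := by
        rw [eventually_all]
        intro i
        by_cases hi : i ∈ L
        · filter_upwards [eventually_gt_atTop 0] with u hu
          rw [heL i hi, zero_mul]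
          refine mul_pos ?_ (hy i hi)
          unfold scv; split_ifs
          · positivity
          · norm_num
        · have hiI : i ∉ I := fun h => hi (hIL h)
          simp only [scv, hiI, if_false, one_mul]
          have : Tendsto (fun u : ℝ => e i * u) atTop atBot :=
            tendsto_id.const_mul_atTop_of_neg (heLc i hi)
          exact this.eventually (eventually_lt_atBot _)
      filter_upwards [hall] with u hu
      rw [Set.indicator_of_mem (by exact hu)]
    · rw [Set.indicator_of_notMem (by exact hy)]
      refine tendsto_const_nhds.congr' ?_
      filter_upwards [eventually_gt_atTop 0] with u hu
      rw [Set.indicator_of_notMem]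
      intro h
      apply hy
      intro i hi
      have := h i
      rw [heL i hi, zero_mul] at this
      refine (mul_pos_iff_of_pos_left ?_).1 this
      unfold scv; split_ifs
      · positivity
      · norm_num

lemma quad_bound {d : ℕ} (A : Matrix (Fin d) (Fin d) ℝ) (hA : A.PosDef)
    (hcorr : ∀ i, A i i = 1) (y : Fin d → ℝ) (j : Fin d) : y j ^ 2 ≤ y ⬝ᵥ A⁻¹ *ᵥ y := by
  have hdet : IsUnit A.det := hA.det_pos.ne'.isUnit
  have hAt : Aᵀ = A := by
    have := hA.isHermitian
    simpa [IsHermitian, conjTranspose_eq_transpose_of_trivial] using this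
  have hBt : A⁻¹ᵀ = A⁻¹ := by rw [transpose_nonsing_inv, hAt]
  set v : Fin d → ℝ := A *ᵥ (Pi.single j 1) with hv
  have h1 : A⁻¹ *ᵥ v = Pi.single j 1 := by
    rw [hv, mulVec_mulVec, nonsing_inv_mul _ hdet, one_mulVec]
  have h2 : v ⬝ᵥ A⁻¹ *ᵥ y = y j := by
    rw [dotProduct_mulVec, ← mulVec_transpose, hBt, h1]; simp
  have h3 : 0 ≤ (y - y j • v) ⬝ᵥ A⁻¹ *ᵥ (y - y j • v) := by
    have := hA.inv.posSemidef.dotProduct_mulVec_nonneg (y - y j • v)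
    simpa using this
  have h4 : v ⬝ᵥ Pi.single j 1 = 1 := by
    rw [hv]; simp [hcorr]
  rw [mulVec_sub, mulVec_smul, h1, sub_dotProduct, dotProduct_sub, dotProduct_sub,
    smul_dotProduct, smul_dotProduct, h2, dotProduct_smul, dotProduct_smul, h4] at h3
  simp at h3
  nlinarith

lemma exists_w {d : ℕ} (A : Matrix (Fin d) (Fin d) ℝ) (hA : A.PosDef) (c bt : Fin d → ℝ)
    (I : Finset (Fin d)) (hI : IsQPIndex A c bt I) :
    ∃ w : Fin d → ℝ, (∀ i ∈ I, 0 < w i) ∧ (∀ i, i ∉ I → w i = 0) ∧ A *ᵥ w = bt := by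
  obtain ⟨_, h1, h2, h3⟩ := hI
  set l := (subM A I I)⁻¹.mulVec (subV c I) with hl
  have hsub : (subM A I I).PosDef := hA.submatrix (e := fun i : ↥I => (i : Fin d))
    Subtype.val_injective
  have hdet : IsUnit (subM A I I).det := hsub.det_pos.ne'.isUnit
  have hrow : ∀ j, (A *ᵥ (fun i => if h : i ∈ I then l ⟨i, h⟩ else 0)) j
      = (fun i : ↥I => A j i) ⬝ᵥ l := by
    intro j
    simp only [mulVec, dotProduct]
    rw [← Finset.sum_subset (Finset.subset_univ I), ← Finset.sum_coe_sort I]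
    · apply Finset.sum_congr rfl
      intro i _
      simp
    · intro i _ hi
      simp [hi]
  refine ⟨fun i => if h : i ∈ I then l ⟨i, h⟩ else 0, ?_, ?_, ?_⟩
  · intro i hi
    simpa [hi] using h2 ⟨i, hi⟩
  · intro i hi
    simp [hi]
  · ext j
    rw [hrow]
    by_cases hj : j ∈ I
    · have : (subM A I I *ᵥ l) ⟨j, hj⟩ = subV c I ⟨j, hj⟩ := by
        rw [hl, mulVec_mulVec, mul_nonsing_inv _ hdet, one_mulVec]
      rw [h1 j hj]
      exact this
    · rw [h3 j hj]

lemma schur_inv {d : ℕ} (A : Matrix (Fin d) (Fin d) ℝ) (hA : A.PosDef) (I : Finset (Fin d)) :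
    (schurC A I)⁻¹ = subM A⁻¹ Iᶜ Iᶜ ∧ 0 < (schurC A I).det := by
  have hdetA : IsUnit A.det := hA.det_pos.ne'.isUnit
  have hsub : (subM A I I).PosDef := hA.submatrix (e := fun i : ↥I => (i : Fin d))
    Subtype.val_injective
  have hdet : IsUnit (subM A I I).det := hsub.det_pos.ne'.isUnit
  have hsubB : (subM A⁻¹ Iᶜ Iᶜ).PosDef := hA.inv.submatrix (e := fun i : ↥Iᶜ => (i : Fin d))
    Subtype.val_injective
  have hAB : A * A⁻¹ = 1 := mul_nonsing_inv _ hdetA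
  have hsplit : ∀ J : Finset (Fin d), subM A J I * subM A⁻¹ I Iᶜ + subM A J Iᶜ * subM A⁻¹ Iᶜ Iᶜ
      = subM (1 : Matrix (Fin d) (Fin d) ℝ) J Iᶜ := by
    intro J
    ext i j
    rw [← hAB]
    simp only [Matrix.add_apply, Matrix.mul_apply, subM]
    rw [Finset.sum_coe_sort I (fun k => A i k * A⁻¹ k j),
      Finset.sum_coe_sort Iᶜ (fun k => A i k * A⁻¹ k j)]
    exact Finset.sum_add_sum_compl I _
  have hs1 := hsplit Iᶜ
  have hs2 := hsplit I
  have e1 : subM (1 : Matrix (Fin d) (Fin d) ℝ) Iᶜ Iᶜ = 1 := by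
    ext i j
    by_cases h : i = j
    · subst h; simp [subM]
    · have h' : (i : Fin d) ≠ j := fun hh => h (Subtype.ext hh)
      simp only [subM, Matrix.one_apply_ne h, Matrix.one_apply_ne h']
  have e2 : subM (1 : Matrix (Fin d) (Fin d) ℝ) I Iᶜ = 0 := by
    ext i j
    have : (i : Fin d) ≠ j := by
      intro h
      exact (Finset.mem_compl.1 j.2) (h ▸ i.2)
    simp [subM, this]
  rw [e1] at hs1
  rw [e2] at hs2
  have hmul : schurC A I * subM A⁻¹ Iᶜ Iᶜ = 1 := by
    have hs3 : subM A⁻¹ I Iᶜ = -((subM A I I)⁻¹ * (subM A I Iᶜ * subM A⁻¹ Iᶜ Iᶜ)) := by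
      have := congrArg (fun M => (subM A I I)⁻¹ * M) hs2
      simp only [Matrix.mul_add, Matrix.mul_zero] at this
      rw [nonsing_inv_mul_cancel_left _ _ hdet] at this
      exact eq_neg_of_add_eq_zero_left this
    rw [schurC, Matrix.sub_mul, ← hs1, hs3]
    simp only [Matrix.mul_assoc, Matrix.mul_neg]
    abel
  refine ⟨inv_eq_right_inv hmul, ?_⟩
  have := congrArg Matrix.det hmul
  rw [det_mul, det_one] at this
  have hp := hsubB.det_pos
  by_contra hneg
  nlinarith

lemma gaussPDF_cont {ι : Type*} [Fintype ι] [DecidableEq ι] (S : Matrix ι ι ℝ) :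
    Continuous (gaussPDF S) := by
  unfold gaussPDF
  simp only [dotProduct, mulVec]
  fun_prop

lemma gaussPDF_nonneg {ι : Type*} [Fintype ι] [DecidableEq ι] (S : Matrix ι ι ℝ) (x : ι → ℝ) :
    0 ≤ gaussPDF S x := by
  unfold gaussPDF; positivity

lemma integral_gauss {ι : Type*} [Fintype ι] [DecidableEq ι] (S : Matrix ι ι ℝ)
    (E : Set (ι → ℝ)) (hE : MeasurableSet E) (f : (ι → ℝ) → ℝ) :
    ∫ x in E, f x ∂((volume : Measure (ι → ℝ)).withDensity
      fun x => ENNReal.ofReal (gaussPDF S x)) = ∫ x, E.indicator (fun x => f x * gaussPDF S x) x := by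
  rw [← integral_indicator hE, integral_withDensity_eq_integral_toReal_smul
    (gaussPDF_cont S).measurable.ennreal_ofReal (ae_of_all _ fun _ => ENNReal.ofReal_lt_top)]
  congr 1
  ext x
  by_cases hx : x ∈ E
  · simp [hx, ENNReal.toReal_ofReal (gaussPDF_nonneg S x), mul_comm]
  · simp [hx]

lemma change_var {d : ℕ} (D a : Fin d → ℝ) (hD : ∀ i, D i ≠ 0) (F : (Fin d → ℝ) → ℝ)
    (hF : Measurable F) :
    ∫ x, F x = |∏ i, D i| * ∫ y : Fin d → ℝ, F (fun i => a i + D i * y i) := by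
  have hdet : det (diagonal D) ≠ 0 := by
    rw [det_diagonal]; exact Finset.prod_ne_zero_iff.2 fun i _ => hD i
  have h1 : ∫ x, F x = ∫ x, F (a + x) := (integral_add_left_eq_self F a).symm
  rw [h1]
  conv_lhs => rw [← Real.smul_map_diagonal_volume_pi hdet]
  rw [integral_smul_measure, integral_map, ENNReal.toReal_ofReal (abs_nonneg _), det_diagonal,
    smul_eq_mul]
  · congr 1
    refine integral_congr_ae (ae_of_all _ fun y => ?_)
    change F _ = F _
    congr 1
    ext i
    simp [toLin'_apply, mulVec_diagonal]
  · exact (LinearMap.continuous_on_pi _).measurable.aemeasurable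
  · exact (hF.comp (measurable_const_add a)).aestronglyMeasurable

lemma gauss_expand {d : ℕ} (A : Matrix (Fin d) (Fin d) ℝ) (hA : A.PosDef) (w bt : Fin d → ℝ)
    (I : Finset (Fin d)) (hw0 : ∀ i, i ∉ I → w i = 0) (hbt : A *ᵥ w = bt) :
    ∀ u : ℝ, 0 < u → ∃ k : ℝ, 0 < k ∧ ∀ y,
      gaussPDF A (fun i => u * bt i + scv I u⁻¹ i * y i) = k * ker0 A⁻¹ w I u⁻¹ y := by
  intro u hu
  have hdetA : IsUnit A.det := hA.det_pos.ne'.isUnit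
  have hAt : Aᵀ = A := by
    have := hA.isHermitian
    simpa [IsHermitian, conjTranspose_eq_transpose_of_trivial] using this
  have hBt : A⁻¹ᵀ = A⁻¹ := by rw [transpose_nonsing_inv, hAt]
  have hBw : A⁻¹ *ᵥ bt = w := by
    rw [← hbt, mulVec_mulVec, nonsing_inv_mul _ hdetA, one_mulVec]
  refine ⟨(Real.sqrt ((2 * Real.pi) ^ Fintype.card (Fin d) * A.det))⁻¹ *
    Real.exp (-(u ^ 2 * (bt ⬝ᵥ w)) / 2), ?_, ?_⟩
  · have := hA.det_pos
    positivity
  · intro y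
    set v : Fin d → ℝ := fun i => scv I u⁻¹ i * y i with hv
    have hx : (fun i => u * bt i + scv I u⁻¹ i * y i) = u • bt + v := by
      ext i; simp [hv]
    have hwv : u * (w ⬝ᵥ v) = w ⬝ᵥ y := by
      simp only [dotProduct, Finset.mul_sum, hv, scv]
      apply Finset.sum_congr rfl
      intro i _
      by_cases hi : i ∈ I
      · simp only [hi, if_true]; field_simp
      · simp [hw0 i hi]
    have h2 : bt ⬝ᵥ A⁻¹ *ᵥ v = w ⬝ᵥ v := by
      rw [dotProduct_mulVec, ← mulVec_transpose, hBt, hBw]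
    rw [hx, gaussPDF, ker0, mul_assoc, ← Real.exp_add]
    congr 2
    rw [mulVec_add, mulVec_smul, hBw, add_dotProduct, dotProduct_add, dotProduct_add,
      smul_dotProduct, smul_dotProduct, dotProduct_smul, dotProduct_smul, h2, dotProduct_comm v w]
    simp only [smul_eq_mul]
    rw [hwv, ← hv]
    ring

lemma sum_scv {d : ℕ} (I : Finset (Fin d)) (h : Fin d → ℝ) :
    ∑ i, scv I 0 i * h i = ∑ j : ↥Iᶜ, h j := by
  rw [Finset.sum_coe_sort Iᶜ h, ← Finset.sum_subset (Finset.subset_univ Iᶜ)]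
  · apply Finset.sum_congr rfl
    intro i hi
    simp [scv, Finset.mem_compl.1 hi]
  · intro i _ hi
    have : i ∈ I := by simpa using hi
    simp [scv, this]

lemma split_int {d : ℕ} (A : Matrix (Fin d) (Fin d) ℝ) (hA : A.PosDef) (w : Fin d → ℝ)
    (I L : Finset (Fin d)) (hw0 : ∀ i, i ∉ I → w i = 0) (hIL : I ⊆ L) :
    ∃ C : ℝ, ∀ F : (↥Iᶜ → ℝ) → ℝ,
      ∫ y, {y : Fin d → ℝ | ∀ i ∈ L, 0 < y i}.indicator
        (fun y => F (fun j => y j) * ker0 A⁻¹ w I 0 y) y =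
      C * ∫ z in {z : ↥Iᶜ → ℝ | ∀ j : ↥Iᶜ, (j : Fin d) ∈ L \ I → 0 < z j}, F z ∂(condNu A I) := by
  obtain ⟨hinv, hdet⟩ := schur_inv A hA I
  set k := (Real.sqrt ((2 * Real.pi) ^ Fintype.card ↥Iᶜ * (schurC A I).det))⁻¹ with hk
  have hkpos : 0 < k := by positivity
  let g : ({i : Fin d // ¬ i ∈ Iᶜ} → ℝ) → ℝ := fun z =>
    {z : {i : Fin d // ¬ i ∈ Iᶜ} → ℝ | ∀ i, 0 < z i}.indicator
      (fun z => Real.exp (-(∑ i : {i : Fin d // ¬ i ∈ Iᶜ}, w i * z i))) z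
  refine ⟨k⁻¹ * ∫ z, g z, fun F => ?_⟩
  have hmeas : MeasurableSet {z : ↥Iᶜ → ℝ | ∀ j : ↥Iᶜ, (j : Fin d) ∈ L \ I → 0 < z j} := by
    simp only [Set.ofPred_forall]
    exact MeasurableSet.iInter fun i => MeasurableSet.iInter fun _ =>
      measurableSet_lt (by fun_prop) (by fun_prop)
  rw [condNu, integral_gauss _ _ hmeas]
  have hmp := volume_preserving_piEquivPiSubtypeProd (fun _ : Fin d => ℝ) (fun i => i ∈ Iᶜ)
  set G : (↥Iᶜ → ℝ) → ℝ := {z : ↥Iᶜ → ℝ | ∀ j : ↥Iᶜ, (j : Fin d) ∈ L \ I → 0 < z j}.indicator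
    (fun z => F z * gaussPDF (schurC A I) z) with hG
  have hint := hmp.integral_comp (MeasurableEquiv.measurableEmbedding _)
    (fun z : (↥Iᶜ → ℝ) × ({i : Fin d // ¬ i ∈ Iᶜ} → ℝ) => G z.1 * g z.2)
  have hprod : ∫ z : (↥Iᶜ → ℝ) × ({i : Fin d // ¬ i ∈ Iᶜ} → ℝ), G z.1 * g z.2
      = (∫ z, G z) * ∫ z, g z := integral_prod_mul G g
  replace hint : ∫ y : Fin d → ℝ, G (fun j : ↥Iᶜ => y j) * g (fun j => y j)
      = (∫ z, G z) * ∫ z, g z := by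
    rw [← hprod]
    convert hint
    all_goals rfl
  rw [mul_assoc, mul_comm (∫ z, g z), ← hint, ← integral_const_mul]
  congr 1
  ext y
  by_cases hy : ∀ i ∈ L, 0 < y i
  · have m1 : (fun j : ↥Iᶜ => y j) ∈
        {z : ↥Iᶜ → ℝ | ∀ j : ↥Iᶜ, (j : Fin d) ∈ L \ I → 0 < z j} :=
      fun j hj => hy j (Finset.mem_sdiff.1 hj).1
    have m2 : (fun j : {i : Fin d // ¬ i ∈ Iᶜ} => y j) ∈
        {z : {i : Fin d // ¬ i ∈ Iᶜ} → ℝ | ∀ i, 0 < z i} :=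
      fun j => hy j (hIL (by simpa using j.2))
    simp only [g]
    rw [Set.indicator_of_mem (by exact hy), hG, Set.indicator_of_mem m1, Set.indicator_of_mem m2,
      gaussPDF, ← hk, hinv, ker0]
    have hq : ((fun i => scv I 0 i * y i) ⬝ᵥ A⁻¹ *ᵥ (fun i => scv I 0 i * y i)) =
        (fun j : ↥Iᶜ => y j) ⬝ᵥ subM A⁻¹ Iᶜ Iᶜ *ᵥ (fun j : ↥Iᶜ => y j) := by
      simp only [dotProduct, mulVec, subM]
      have e1 : ∀ i : Fin d, ∑ j, A⁻¹ i j * (scv I 0 j * y j) = ∑ j : ↥Iᶜ, A⁻¹ i j * y j := by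
        intro i
        rw [← sum_scv I (fun j => A⁻¹ i j * y j)]
        apply Finset.sum_congr rfl; intros; ring
      simp only [e1]
      rw [← sum_scv I (fun i => y i * ∑ j : ↥Iᶜ, A⁻¹ i j * y j)]
      apply Finset.sum_congr rfl; intros; ring
    have hs : w ⬝ᵥ y = ∑ i : {i : Fin d // ¬ i ∈ Iᶜ}, w i * y i := by
      rw [dotProduct, ← Fintype.sum_subtype_add_sum_subtype (fun i => i ∈ Iᶜ) (fun i => w i * y i)]
      rw [add_eq_right]
      apply Finset.sum_eq_zero
      intro i _
      rw [hw0 i (Finset.mem_compl.1 i.2), zero_mul]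
    rw [hq, hs, sub_eq_add_neg, Real.exp_add, neg_div]
    field_simp
  · rw [Set.indicator_of_notMem (by exact hy)]
    push Not at hy
    obtain ⟨i, hiL, hi⟩ := hy
    by_cases hiI : i ∈ I
    · have : g (fun j => y j) = 0 := by
        apply Set.indicator_of_notMem
        intro h
        exact absurd (h ⟨i, by simpa using hiI⟩) (not_lt.2 hi)
      rw [this]; simp
    · have : G (fun j : ↥Iᶜ => y j) = 0 := by
        apply Set.indicator_of_notMem
        intro h
        exact absurd (h ⟨i, by simpa using hiI⟩ (by simp [hiL, hiI])) (not_lt.2 hi)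
      rw [this]; simp

lemma int_pos {d : ℕ} (B : Matrix (Fin d) (Fin d) ℝ) (w : Fin d → ℝ)
    (I L : Finset (Fin d))
    (hint : Integrable ({y : Fin d → ℝ | ∀ i ∈ L, 0 < y i}.indicator
      (fun y => 1 * ker0 B w I 0 y))) :
    0 < ∫ y, {y : Fin d → ℝ | ∀ i ∈ L, 0 < y i}.indicator
        (fun y => 1 * ker0 B w I 0 y) y := by
  rw [integral_pos_iff_support_of_nonneg
    (fun y => Set.indicator_nonneg (fun y _ => by unfold ker0; positivity) y) hint]
  have hopen : IsOpen {y : Fin d → ℝ | ∀ i, 0 < y i} := by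
    simp only [Set.ofPred_forall]
    exact isOpen_iInter_of_finite fun i => isOpen_lt continuous_const (continuous_apply i)
  have hne : {y : Fin d → ℝ | ∀ i, 0 < y i}.Nonempty := ⟨fun _ => 1, fun _ => one_pos⟩
  refine (hopen.measure_pos volume hne).trans_le (measure_mono ?_)
  intro y hy
  rw [Function.mem_support, Set.indicator_of_mem (show y ∈ {y : Fin d → ℝ | ∀ i ∈ L, 0 < y i} from fun i _ => hy i)]
  unfold ker0
  positivity

/-- Theorem 2.4 (MCTE refinement): if `1 ∈ L^c` and `c̃_1 = Σ_{1,I}(Σ_II)⁻¹c_I`, then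
`M(c,u) - c̃_1 u → E[Y]` as `u → ∞`, where `Y` is the distributional limit of
`X_1 - c̃_1 u` given `X > c u`, with survival function
`Ḡ(x) = P(X_1 > x, X_{N*} > 0 | X_I = 0)/P(X_{N*} > 0 | X_I = 0)`, `N* = L \ I`
(so that `Ḡ(x) = P(X_1 > x | X_I = 0)` when `L = I`). -/
theorem mcte_multivariate_gaussian_refinement
    {Ω : Type*} [MeasurableSpace Ω] (P : Measure Ω) [IsProbabilityMeasure P]
    {d : ℕ} [NeZero d] (A : Matrix (Fin d) (Fin d) ℝ) (hA : A.PosDef)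
    (hcorr : ∀ i, A i i = 1)
    (X : Ω → Fin d → ℝ) (hX : Measurable X) (hG : IsCenteredGaussianRV P X A)
    (c : Fin d → ℝ) (hc : ∃ i, 0 < c i)
    (bt : Fin d → ℝ) (I L : Finset (Fin d))
    (hsol : IsQPSol A c bt) (hI : IsQPIndex A c bt I) (hL : ∀ i, i ∈ L ↔ bt i = c i)
    (h1Lc : (0 : Fin d) ∉ L) :
    Tendsto (fun u => mcteV P X c u - rowDot A c I 0 * u) atTop
      (𝓝 (condMean A I (L \ I) 0)) := by
  have hIL : I ⊆ L := fun i hi => (hL i).2 (hI.2.1 i hi)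
  have h0 : (0 : Fin d) ∉ I := fun h => h1Lc (hIL h)
  obtain ⟨w, hw, hw0, hbt⟩ := exists_w A hA c bt I hI
  have hB := quad_bound A hA hcorr
  have hrow : rowDot A c I 0 = bt 0 := (hI.2.2.2 0 h0).symm
  rw [hrow]
  set e : Fin d → ℝ := fun i => c i - bt i with he
  have heL : ∀ i ∈ L, e i = 0 := fun i hi => by simp [he, (hL i).1 hi]
  have heLc : ∀ i, i ∉ L → e i < 0 := fun i hi => by
    have h1 : bt i ≠ c i := fun h => hi ((hL i).2 h)
    have h2 := lt_of_le_of_ne (hsol.1 i) h1.symm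
    simp only [he]; linarith
  have hf1 : Measurable (fun _ : Fin d → ℝ => (1:ℝ)) := measurable_const
  have hf1b : ∀ y : Fin d → ℝ, |(1:ℝ)| ≤ 1 + |y 0| := fun y => by simp
  have hf2 : Measurable (fun y : Fin d → ℝ => y 0) := measurable_pi_apply 0
  have hf2b : ∀ y : Fin d → ℝ, |y 0| ≤ 1 + |y 0| := fun y => by linarith
  have T1 := key_tendsto A⁻¹ w e I L hw hw0 h0 hB hIL heL heLc _ hf1 hf1b
  have T2 := key_tendsto A⁻¹ w e I L hw hw0 h0 hB hIL heL heLc _ hf2 hf2b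
  have hDpos := int_pos A⁻¹ w I L (ind_integrable A⁻¹ w I hw hw0 h0 hB _ hf1 hf1b _
    (posL_meas L) (fun y hy i hi => hy i (hIL hi)) 0)
  -- the limit
  have hlim : condMean A I (L \ I) 0 =
      (∫ y, {y : Fin d → ℝ | ∀ i ∈ L, 0 < y i}.indicator
        (fun y => y 0 * ker0 A⁻¹ w I 0 y) y) /
      (∫ y, {y : Fin d → ℝ | ∀ i ∈ L, 0 < y i}.indicator
        (fun y => 1 * ker0 A⁻¹ w I 0 y) y) := by
    obtain ⟨C, hC⟩ := split_int A hA w I L hw0 hIL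
    have hC1 := hC (fun _ => 1)
    have h0c : (0 : Fin d) ∈ Iᶜ := Finset.mem_compl.2 h0
    have hC2 := hC (fun z => z ⟨0, h0c⟩)
    beta_reduce at hC1 hC2
    rw [hC1] at hDpos ⊢
    rw [hC2]
    have hCne : C ≠ 0 := by
      intro h; rw [h, zero_mul] at hDpos; exact lt_irrefl _ hDpos
    rw [mul_div_mul_left _ _ hCne, condMean, setIntegral_const, smul_eq_mul, mul_one]
    congr 1
    congr 1
    ext z
    rw [Finset.sum_eq_single (⟨0, h0c⟩ : ↥Iᶜ)]
    · simp
    · intro j _ hj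
      rw [if_neg]
      intro h
      exact hj (Subtype.ext h)
    · simp
  rw [hlim]
  refine (T2.div T1 hDpos.ne').congr' ?_
  filter_upwards [eventually_gt_atTop 0, T1.eventually_ne hDpos.ne'] with u hu hne
  obtain ⟨k, hk, hpdf⟩ := gauss_expand A hA w bt I hw0 hbt u hu
  have hD : ∀ i, scv I u⁻¹ i ≠ 0 := by
    intro i; unfold scv; split_ifs
    · positivity
    · norm_num
  have hEm : MeasurableSet {x : Fin d → ℝ | ∀ i, c i * u < x i} := by
    simp only [Set.ofPred_forall]
    exact MeasurableSet.iInter fun i => measurableSet_lt (by fun_prop) (by fun_prop)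
  have hpush : ∀ f : (Fin d → ℝ) → ℝ, Measurable f →
      ∫ ω in {ω | ∀ i, c i * u < X ω i}, f (X ω) ∂P =
        (|∏ i, scv I u⁻¹ i| * k) * ∫ y, (setU e I u).indicator
          (fun y => f (fun i => u * bt i + scv I u⁻¹ i * y i) * ker0 A⁻¹ w I u⁻¹ y) y := by
    intro f hf
    have s1 : ∫ ω in {ω | ∀ i, c i * u < X ω i}, f (X ω) ∂P =
        ∫ x in {x : Fin d → ℝ | ∀ i, c i * u < x i}, f x ∂(Measure.map X P) :=
      (setIntegral_map hEm hf.aestronglyMeasurable hX.aemeasurable).symm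
    rw [s1, hG, integral_gauss _ _ hEm, change_var (scv I u⁻¹) (fun i => u * bt i) hD
      ({x : Fin d → ℝ | ∀ i, c i * u < x i}.indicator (fun x => f x * gaussPDF A x))
      ((hf.mul (gaussPDF_cont A).measurable).indicator hEm), mul_assoc]
    congr 1
    rw [← integral_const_mul]
    congr 1
    ext y
    have hiff : ((fun i => u * bt i + scv I u⁻¹ i * y i) ∈
        {x : Fin d → ℝ | ∀ i, c i * u < x i}) ↔ y ∈ setU e I u := by
      apply forall_congr'
      intro i
      simp only [he]
      constructor <;> intro h <;> linarith
    by_cases hy : y ∈ setU e I u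
    · rw [Set.indicator_of_mem hy, Set.indicator_of_mem (hiff.2 hy), hpdf]
      ring
    · rw [Set.indicator_of_notMem hy, Set.indicator_of_notMem (fun h => hy (hiff.1 h))]
      ring
  have hkk : |∏ i, scv I u⁻¹ i| * k ≠ 0 :=
    mul_ne_zero (abs_ne_zero.2 (Finset.prod_ne_zero_iff.2 fun i _ => hD i)) hk.ne'
  have p1 := hpush (fun _ => 1) hf1
  have p2 := hpush (fun y => y 0) hf2
  rw [setIntegral_const, smul_eq_mul, mul_one] at p1
  have hs : ∀ y ∈ setU e I u, ∀ i ∈ I, 0 < y i := fun y hy =>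
    setU_pos e I (fun i hi => heL i (hIL hi)) hu hy
  have i1 := ind_integrable A⁻¹ w I hw hw0 h0 hB _ hf1 hf1b _ (setU_meas e I u) hs u⁻¹
  have i2 := ind_integrable A⁻¹ w I hw hw0 h0 hB _ hf2 hf2b _ (setU_meas e I u) hs u⁻¹
  have hadd : ∫ y, (setU e I u).indicator
        (fun y => (u * bt 0 + scv I u⁻¹ 0 * y 0) * ker0 A⁻¹ w I u⁻¹ y) y =
      u * bt 0 * (∫ y, (setU e I u).indicator (fun y => 1 * ker0 A⁻¹ w I u⁻¹ y) y) +
      ∫ y, (setU e I u).indicator (fun y => y 0 * ker0 A⁻¹ w I u⁻¹ y) y := by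
    rw [← integral_const_mul, ← integral_add (i1.const_mul _) i2]
    congr 1
    ext y
    by_cases hy : y ∈ setU e I u
    · simp only [Set.indicator_of_mem hy, scv, h0, if_false]
      ring
    · simp only [Set.indicator_of_notMem hy]
      ring
  have hreal : (P {ω | ∀ i, c i * u < X ω i}).toReal = P.real {ω | ∀ i, c i * u < X ω i} := rfl
  rw [mcteV, hreal, p1, p2, hadd, mul_div_mul_left _ _ hkk, Pi.div_apply]
  rw [add_div, mul_div_cancel_right₀ _ hne]
  ring
end
end

section
/- Let X be a centered d-dimensional Gaussian random vector with non-singular covariance matrix \Sigma and let c \in R^d have at least one positive component, with I, L the index sets determined by \Pi_\Sigma(c) and N = L \setminus I. Let x(u), u > 0, be d-dimensional vectors with x(u)/u \to 0 and suppose (x(u))_{I \cup N} \to x_{I \cup N} as u \to \infty. Then lim_{u \to \infty} P(X > c u + x(u)) / P(X_I > (c u + x(u))_I) = lim_{u \to \infty} P(X_L > (c u + x(u))_L) / P(X_I > (c u + x(u))_I) = P(X_N > x_N | X_I = x_I), where the last probability is set to 1 if N is empty and the conditioning refers to the Gaussian conditional distribution. -/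
open MeasureTheory ProbabilityTheory Filter Matrix
open scoped Topology ENNReal

noncomputable section

/-- The conditional law of `X_{I^c}` given `X_I = x_I` (Gaussian with mean
`Σ_{I^cI}(Σ_II)⁻¹x_I` and covariance the Schur complement). -/
def condNuAt {ι : Type*} [Fintype ι] [DecidableEq ι] (A : Matrix ι ι ℝ) (I : Finset ι)
    (xl : ι → ℝ) : Measure (↥Iᶜ → ℝ) :=
  (volume : Measure (↥Iᶜ → ℝ)).withDensity fun y =>
    ENNReal.ofReal (gaussPDF (schurC A I)
      (y - (subM A Iᶜ I).mulVec ((subM A I I)⁻¹.mulVec (subV xl I))))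


lemma aux_schur_posDef {m n : Type*} [Fintype m] [Fintype n] [DecidableEq m] [DecidableEq n]
    (Q : Matrix m m ℝ) (R : Matrix m n ℝ) (D : Matrix n n ℝ)
    (h : (fromBlocks Q R Rᵀ D).PosDef) (hQ : Q.PosDef) :
    (D - Rᵀ * Q⁻¹ * R).PosDef ∧
      (fromBlocks Q R Rᵀ D).det = Q.det * (D - Rᵀ * Q⁻¹ * R).det := by
  let _ : Invertible Q := hQ.isUnit.invertible
  have hdet : (fromBlocks Q R Rᵀ D).det = Q.det * (D - Rᵀ * Q⁻¹ * R).det := by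
    rw [det_fromBlocks₁₁, invOf_eq_nonsing_inv]
  refine ⟨?_, hdet⟩
  have hs : (D - Rᴴ * Q⁻¹ * R).PosSemidef := by
    rw [← PosDef.fromBlocks₁₁ R D hQ]
    simpa using h.posSemidef
  rw [conjTranspose_eq_transpose_of_trivial] at hs
  rw [hs.posDef_iff_det_ne_zero]
  intro h0
  have := h.det_pos
  rw [hdet, h0] at this
  simp at this

lemma aux_quad {m n : Type*} [Fintype m] [Fintype n] [DecidableEq m] [DecidableEq n]
    (Q : Matrix m m ℝ) (R : Matrix m n ℝ) (D : Matrix n n ℝ)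
    (h : (fromBlocks Q R Rᵀ D).PosDef) (hQ : Q.PosDef) (p : m → ℝ) (q : n → ℝ) :
    Sum.elim p q ⬝ᵥ (fromBlocks Q R Rᵀ D)⁻¹ *ᵥ Sum.elim p q =
      p ⬝ᵥ Q⁻¹ *ᵥ p + (q - Rᵀ *ᵥ (Q⁻¹ *ᵥ p)) ⬝ᵥ
        (D - Rᵀ * Q⁻¹ * R)⁻¹ *ᵥ (q - Rᵀ *ᵥ (Q⁻¹ *ᵥ p)) := by
  obtain ⟨hS, -⟩ := aux_schur_posDef Q R D h hQ
  have hQd : IsUnit Q.det := hQ.det_pos.ne'.isUnit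
  have hSd : IsUnit (D - Rᵀ * Q⁻¹ * R).det := hS.det_pos.ne'.isUnit
  have hd : IsUnit (fromBlocks Q R Rᵀ D).det := h.det_pos.ne'.isUnit
  let _ : Invertible Q := hQ.isUnit.invertible
  obtain ⟨v1, v2, hv⟩ : ∃ v1 v2, (fromBlocks Q R Rᵀ D)⁻¹ *ᵥ Sum.elim p q = Sum.elim v1 v2 :=
    ⟨_, _, (Sum.elim_comp_inl_inr _).symm⟩
  have hv' : Sum.elim p q = (fromBlocks Q R Rᵀ D) *ᵥ Sum.elim v1 v2 := by
    rw [← hv, mulVec_mulVec, mul_nonsing_inv _ hd, one_mulVec]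
  rw [hv]
  have key := schur_complement_eq₁₁ R D v1 v2 hQ.isHermitian
  simp only [star_trivial, conjTranspose_eq_transpose_of_trivial] at key
  have hp : p = Q *ᵥ (v1 + (Q⁻¹ * R) *ᵥ v2) := by
    have := congrArg (· ∘ Sum.inl) hv'
    simp only [Sum.elim_comp_inl, fromBlocks_mulVec] at this
    rw [this, mulVec_add, mulVec_mulVec, ← Matrix.mul_assoc, mul_nonsing_inv _ hQd, Matrix.one_mul]
    simp
  have hq : q = Rᵀ *ᵥ v1 + D *ᵥ v2 := by
    have := congrArg (· ∘ Sum.inr) hv'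
    simpa only [Sum.elim_comp_inr, fromBlocks_mulVec, Sum.elim_comp_inl] using this
  have hQp : Q⁻¹ *ᵥ p = v1 + (Q⁻¹ * R) *ᵥ v2 := by
    rw [hp, mulVec_mulVec, nonsing_inv_mul _ hQd, one_mulVec]
  have hq2 : q - Rᵀ *ᵥ (Q⁻¹ *ᵥ p) = (D - Rᵀ * Q⁻¹ * R) *ᵥ v2 := by
    rw [hQp, hq, mulVec_add, sub_mulVec, mulVec_mulVec, Matrix.mul_assoc]
    abel
  rw [hq2, hQp, mulVec_mulVec, nonsing_inv_mul _ hSd, one_mulVec]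
  have e1 : Sum.elim p q ⬝ᵥ Sum.elim v1 v2 =
      Sum.elim v1 v2 ᵥ* fromBlocks Q R Rᵀ D ⬝ᵥ Sum.elim v1 v2 := by
    rw [hv', ← dotProduct_mulVec, dotProduct_comm]
  rw [e1, key, ← dotProduct_mulVec, ← dotProduct_mulVec, ← hp]
  rw [dotProduct_comm v2, dotProduct_comm p]

lemma aux_factor {m n : Type*} [Fintype m] [Fintype n] [DecidableEq m] [DecidableEq n]
    (Q : Matrix m m ℝ) (R : Matrix m n ℝ) (D : Matrix n n ℝ)
    (h : (fromBlocks Q R Rᵀ D).PosDef) (hQ : Q.PosDef) (p : m → ℝ) (q : n → ℝ) :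
    gaussPDF (fromBlocks Q R Rᵀ D) (Sum.elim p q) =
      gaussPDF Q p * gaussPDF (D - Rᵀ * Q⁻¹ * R) (q - Rᵀ *ᵥ (Q⁻¹ *ᵥ p)) := by
  obtain ⟨hS, hdet⟩ := aux_schur_posDef Q R D h hQ
  unfold gaussPDF
  rw [aux_quad Q R D h hQ, hdet, Fintype.card_sum, pow_add]
  have : (2 * Real.pi) ^ Fintype.card m * (2 * Real.pi) ^ Fintype.card n *
      (Q.det * (D - Rᵀ * Q⁻¹ * R).det) = ((2 * Real.pi) ^ Fintype.card m * Q.det) *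
      ((2 * Real.pi) ^ Fintype.card n * (D - Rᵀ * Q⁻¹ * R).det) := by ring
  rw [this, Real.sqrt_mul (by have := hQ.det_pos; positivity), mul_inv]
  rw [neg_add, add_div, Real.exp_add]
  ring

lemma aux_reindex {m n : Type*} [Fintype m] [Fintype n] [DecidableEq m] [DecidableEq n]
    (e : m ≃ n) (A : Matrix n n ℝ) (v : n → ℝ) :
    gaussPDF A v = gaussPDF (A.submatrix e e) (v ∘ e) := by
  unfold gaussPDF
  rw [det_submatrix_equiv_self, Fintype.card_congr e, inv_submatrix_equiv,
    submatrix_mulVec_equiv]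
  congr 4
  have : (v ∘ e) ∘ e.symm = v := by ext; simp
  rw [this]
  simp only [dotProduct, Function.comp]
  exact (e.sum_comp (fun i => v i * (A⁻¹ *ᵥ v) i)).symm

lemma aux_gaussPDF_nonneg {n : Type*} [Fintype n] [DecidableEq n]
    (S : Matrix n n ℝ) (v : n → ℝ) : 0 ≤ gaussPDF S v := by
  unfold gaussPDF; positivity

lemma aux_gaussPDF_cont {n : Type*} [Fintype n] [DecidableEq n]
    (S : Matrix n n ℝ) : Continuous (gaussPDF S) := by
  unfold gaussPDF; fun_prop

lemma aux_std {n : Type*} [Fintype n] :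
    ∫⁻ v : n → ℝ, ENNReal.ofReal (Real.exp (-(v ⬝ᵥ v) / 2)) =
      ENNReal.ofReal (Real.sqrt (2 * Real.pi) ^ Fintype.card n) := by
  have hf : ∀ v : n → ℝ, Real.exp (-(v ⬝ᵥ v) / 2) = ∏ i, Real.exp (-(1/2) * (v i) ^ 2) := by
    intro v
    rw [← Real.exp_sum]
    congr 1
    simp only [dotProduct, ← Finset.mul_sum]
    have : ∀ i, v i * v i = v i ^ 2 := fun i => by ring
    simp only [this]
    ring
  simp only [hf]
  rw [← ofReal_integral_eq_lintegral_ofReal]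
  · rw [integral_fintype_prod_volume_eq_pow (fun y : ℝ => Real.exp (-(1/2) * y ^ 2)), integral_gaussian]
    congr 3
    ring
  · exact Integrable.fintype_prod (f := fun _ y => Real.exp (-(1/2) * y ^ 2))
      (fun i => integrable_exp_neg_mul_sq (by norm_num))
  · exact Eventually.of_forall fun v => by positivity

open scoped MatrixOrder in
lemma aux_gauss_one {n : Type*} [Fintype n] [DecidableEq n]
    (S : Matrix n n ℝ) (hS : S.PosDef) :
    ∫⁻ v, ENNReal.ofReal (gaussPDF S v) = 1 := by
  obtain ⟨y, hy⟩ := CStarAlgebra.nonneg_iff_eq_star_mul_self.mp hS.inv.posSemidef.nonneg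
  rw [star_eq_conjTranspose, conjTranspose_eq_transpose_of_trivial] at hy
  have hdet : S.det⁻¹ = y.det ^ 2 := by
    have := congrArg det hy
    rw [det_mul, det_transpose, det_nonsing_inv, Ring.inverse_eq_inv] at this
    rw [this]; ring
  have hSp := hS.det_pos
  have hy0 : y.det ≠ 0 := by
    intro h0
    rw [h0] at hdet
    have := inv_pos.mpr hSp
    simp [hdet] at this
  have hd : S.det = (|y.det|⁻¹) ^ 2 := by
    rw [inv_pow, sq_abs, ← hdet, inv_inv]
  have hf : ∀ v, gaussPDF S v = (Real.sqrt (2 * Real.pi) ^ Fintype.card n)⁻¹ * |y.det| *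
      Real.exp (-((toLin' y v) ⬝ᵥ (toLin' y v)) / 2) := by
    intro v
    unfold gaussPDF
    rw [hy]
    have : Real.sqrt ((2 * Real.pi) ^ Fintype.card n * S.det) =
      Real.sqrt (2 * Real.pi) ^ Fintype.card n * |y.det|⁻¹ := by
      rw [hd, Real.sqrt_mul (by positivity), Real.sqrt_sq (by positivity)]
      congr 1
      rw [Real.sqrt_eq_iff_mul_self_eq (by positivity) (by positivity), ← mul_pow,
        Real.mul_self_sqrt (by positivity)]
    rw [this, mul_inv, inv_inv]
    congr 4
    rw [toLin'_apply, ← mulVec_mulVec, dotProduct_mulVec, vecMul_transpose]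
  have hpos : 0 ≤ (Real.sqrt (2 * Real.pi) ^ Fintype.card n)⁻¹ * |y.det| := by positivity
  simp only [hf]
  simp_rw [ENNReal.ofReal_mul hpos]
  have hm : Measurable fun v : n → ℝ => ENNReal.ofReal (Real.exp (-(v ⬝ᵥ v) / 2)) := by
    have : Continuous fun v : n → ℝ => (Real.exp (-(v ⬝ᵥ v) / 2)) := by fun_prop
    exact this.measurable.ennreal_ofReal
  have ht : Measurable (toLin' y) := (LinearMap.continuous_of_finiteDimensional (toLin' y)).measurable
  have hmt : Measurable fun v : n → ℝ =>
      ENNReal.ofReal (Real.exp (-((toLin' y v) ⬝ᵥ (toLin' y v)) / 2)) := hm.comp ht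
  rw [lintegral_const_mul _ hmt, ← lintegral_map hm ht,
    Real.map_matrix_volume_pi_eq_smul_volume_pi hy0, lintegral_smul_measure, aux_std, smul_eq_mul,
    ← ENNReal.ofReal_mul (by positivity), ← ENNReal.ofReal_mul hpos, ENNReal.ofReal_eq_one]
  rw [abs_inv]
  have : Real.sqrt (2 * Real.pi) ^ Fintype.card n ≠ 0 := by positivity
  have : |y.det| ≠ 0 := by positivity
  field_simp

/-- rescaled event -/
def auxE {m n : Type*} [Fintype m] (M : Matrix n m ℝ)
    (c0 : m → ℝ) (a : m → ℝ) (b : n → ℝ) (K : n → Prop) (u : ℝ) : Set ((m → ℝ) × (n → ℝ)) :=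
  {z | (∀ i, 0 < z.1 i) ∧ ∀ j, K j → b j - u * (M *ᵥ c0) j - (M *ᵥ (a + u⁻¹ • z.1)) j < z.2 j}

/-- rescaled integrand -/
def auxf {m n : Type*} [Fintype m] [DecidableEq m] [Fintype n] [DecidableEq n]
    (Q : Matrix m m ℝ) (S : Matrix n n ℝ)
    (c0 : m → ℝ) (a : m → ℝ) (u : ℝ) (z : (m → ℝ) × (n → ℝ)) : ℝ≥0∞ :=
  ENNReal.ofReal (Real.exp (-((Q⁻¹ *ᵥ c0) ⬝ᵥ z.1)) *
    Real.exp (-((a + u⁻¹ • z.1) ⬝ᵥ Q⁻¹ *ᵥ (a + u⁻¹ • z.1)) / 2) * gaussPDF S z.2)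

/-- normalisation -/
def auxκ {m : Type*} [Fintype m] [DecidableEq m]
    (Q : Matrix m m ℝ) (c0 : m → ℝ) (a : m → ℝ) (u : ℝ) : ℝ :=
  (u ^ Fintype.card m)⁻¹ * ((Real.sqrt ((2 * Real.pi) ^ Fintype.card m * Q.det))⁻¹ *
    Real.exp (-(u ^ 2 * (c0 ⬝ᵥ Q⁻¹ *ᵥ c0) + 2 * u * ((Q⁻¹ *ᵥ c0) ⬝ᵥ a)) / 2))

lemma aux_measE {m n : Type*} [Fintype m] [Fintype n] (M : Matrix n m ℝ)
    (c0 : m → ℝ) (a : m → ℝ) (b : n → ℝ) (K : n → Prop) (u : ℝ) :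
    MeasurableSet (auxE M c0 a b K u) := by
  unfold auxE
  simp only [Set.ofPred_and, Set.ofPred_forall]
  refine MeasurableSet.inter (MeasurableSet.iInter fun i => ?_)
    (MeasurableSet.iInter fun j => MeasurableSet.iInter fun _ => ?_)
  · exact measurableSet_lt measurable_const (by fun_prop)
  · refine measurableSet_lt ?_ (by fun_prop)
    have : Continuous fun z : (m → ℝ) × (n → ℝ) =>
      b j - u * (M *ᵥ c0) j - (M *ᵥ (a + u⁻¹ • z.1)) j := by fun_prop
    exact this.measurable

lemma aux_measf {m n : Type*} [Fintype m] [DecidableEq m] [Fintype n] [DecidableEq n]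
    (Q : Matrix m m ℝ) (S : Matrix n n ℝ)
    (c0 : m → ℝ) (a : m → ℝ) (u : ℝ) : Measurable (auxf Q S c0 a u) := by
  unfold auxf
  have h := aux_gaussPDF_cont S
  have : Continuous fun z : (m → ℝ) × (n → ℝ) => Real.exp (-((Q⁻¹ *ᵥ c0) ⬝ᵥ z.1)) *
    Real.exp (-((a + u⁻¹ • z.1) ⬝ᵥ Q⁻¹ *ᵥ (a + u⁻¹ • z.1)) / 2) * gaussPDF S z.2 := by
      fun_prop
  exact this.measurable.ennreal_ofReal

lemma aux_scale {m : Type*} [Fintype m] (H : (m → ℝ) → ℝ≥0∞) (v : m → ℝ) {u : ℝ} (hu : 0 < u) :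
    ∫⁻ p, H p = ENNReal.ofReal ((u ^ Fintype.card m)⁻¹) * ∫⁻ z, H (v + u⁻¹ • z) := by
  have h1 : ∫⁻ z, H (v + u⁻¹ • z) = ENNReal.ofReal (u ^ Fintype.card m) * ∫⁻ p, H p := by
    have := (measurableEmbedding_const_smul₀ (α := m → ℝ) (inv_ne_zero hu.ne')).lintegral_map
      (μ := volume) (fun z => H (v + z))
    rw [← this, Measure.map_addHaar_smul _ (inv_ne_zero hu.ne'), lintegral_smul_measure,
      lintegral_add_left_eq_self, smul_eq_mul]
    congr 2
    rw [Module.finrank_fintype_fun_eq_card, inv_pow, inv_inv, abs_of_pos (by positivity)]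
  rw [h1, ← mul_assoc, ← ENNReal.ofReal_mul (by positivity), inv_mul_cancel₀ (by positivity)]
  simp

lemma aux_symm {m : Type*} [Fintype m] [DecidableEq m] (Q : Matrix m m ℝ) (hQ : Q.PosDef)
    (x y : m → ℝ) : x ⬝ᵥ Q⁻¹ *ᵥ y = (Q⁻¹ *ᵥ x) ⬝ᵥ y := by
  rw [dotProduct_mulVec, ← mulVec_transpose]
  have : Q⁻¹ᵀ = Q⁻¹ := by
    have := hQ.inv.isHermitian.eq
    rwa [conjTranspose_eq_transpose_of_trivial] at this
  rw [this]

lemma aux_expand {m : Type*} [Fintype m] [DecidableEq m] (Q : Matrix m m ℝ) (hQ : Q.PosDef)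
    (c0 a z : m → ℝ) {u : ℝ} (hu : 0 < u) :
    gaussPDF Q (u • c0 + a + u⁻¹ • z) =
     ((Real.sqrt ((2 * Real.pi) ^ Fintype.card m * Q.det))⁻¹ *
      Real.exp (-(u ^ 2 * (c0 ⬝ᵥ Q⁻¹ *ᵥ c0) + 2 * u * ((Q⁻¹ *ᵥ c0) ⬝ᵥ a)) / 2)) *
      (Real.exp (-((Q⁻¹ *ᵥ c0) ⬝ᵥ z)) *
       Real.exp (-((a + u⁻¹ • z) ⬝ᵥ Q⁻¹ *ᵥ (a + u⁻¹ • z)) / 2)) := by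
  unfold gaussPDF
  rw [mul_assoc, ← Real.exp_add, ← Real.exp_add]
  congr 2
  have h1 : ∀ q : m → ℝ, (u • c0 + q) ⬝ᵥ Q⁻¹ *ᵥ (u • c0 + q) =
     u ^ 2 * (c0 ⬝ᵥ Q⁻¹ *ᵥ c0) + 2 * u * ((Q⁻¹ *ᵥ c0) ⬝ᵥ q) + q ⬝ᵥ Q⁻¹ *ᵥ q := by
    intro q
    simp only [mulVec_add, mulVec_smul, add_dotProduct, dotProduct_add, smul_dotProduct,
      dotProduct_smul, smul_eq_mul]
    rw [aux_symm Q hQ c0 q, dotProduct_comm q (Q⁻¹ *ᵥ c0)]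
    ring
  rw [add_assoc, h1]
  have h2 : (Q⁻¹ *ᵥ c0) ⬝ᵥ (a + u⁻¹ • z) = (Q⁻¹ *ᵥ c0) ⬝ᵥ a + u⁻¹ * ((Q⁻¹ *ᵥ c0) ⬝ᵥ z) := by
    simp
  rw [h2]
  field_simp
  ring

lemma aux_cov {m n : Type*} [Fintype m] [DecidableEq m] [Fintype n] [DecidableEq n]
    (Q : Matrix m m ℝ) (hQ : Q.PosDef) (S : Matrix n n ℝ) (M : Matrix n m ℝ)
    (c0 a : m → ℝ) (b : n → ℝ) (K : n → Prop) {u : ℝ} (hu : 0 < u) :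
    ∫⁻ p : m → ℝ, ∫⁻ q : n → ℝ,
      {z : (m → ℝ) × (n → ℝ) | (∀ i, u * c0 i + a i < z.1 i) ∧ ∀ j, K j → b j < z.2 j}.indicator
        (fun z => ENNReal.ofReal (gaussPDF Q z.1 * gaussPDF S (z.2 - M *ᵥ z.1))) (p, q) =
    ENNReal.ofReal (auxκ Q c0 a u) *
      ∫⁻ z, (auxE M c0 a b K u).indicator (auxf Q S c0 a u) z := by
  set G : (m → ℝ) × (n → ℝ) → ℝ≥0∞ :=
    {z : (m → ℝ) × (n → ℝ) | (∀ i, u * c0 i + a i < z.1 i) ∧ ∀ j, K j → b j < z.2 j}.indicator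
        (fun z => ENNReal.ofReal (gaussPDF Q z.1 * gaussPDF S (z.2 - M *ᵥ z.1))) with hG
  have h1 : ∀ p, ∫⁻ q, G (p, q) = ∫⁻ y, G (p, y + M *ᵥ p) := fun p =>
    (lintegral_add_right_eq_self (fun q => G (p, q)) (M *ᵥ p)).symm
  simp only [h1]
  rw [aux_scale _ (u • c0 + a) hu]
  set k := (Real.sqrt ((2 * Real.pi) ^ Fintype.card m * Q.det))⁻¹ *
    Real.exp (-(u ^ 2 * (c0 ⬝ᵥ Q⁻¹ *ᵥ c0) + 2 * u * ((Q⁻¹ *ᵥ c0) ⬝ᵥ a)) / 2) with hk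
  have hk0 : 0 ≤ k := by positivity
  have hκ : auxκ Q c0 a u = (u ^ Fintype.card m)⁻¹ * k := rfl
  rw [hκ, ENNReal.ofReal_mul (by positivity), mul_assoc]
  congr 1
  rw [Measure.volume_eq_prod, lintegral_prod _
    (((aux_measf Q S c0 a u).indicator (aux_measE M c0 a b K u)).aemeasurable),
    ← lintegral_const_mul' _ _ ENNReal.ofReal_ne_top]
  congr 1
  ext z
  rw [← lintegral_const_mul' _ _ ENNReal.ofReal_ne_top]
  congr 1
  ext y
  have hiff : ((u • c0 + a + u⁻¹ • z, y + M *ᵥ (u • c0 + a + u⁻¹ • z)) ∈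
      {z : (m → ℝ) × (n → ℝ) | (∀ i, u * c0 i + a i < z.1 i) ∧ ∀ j, K j → b j < z.2 j}) ↔
      (z, y) ∈ auxE M c0 a b K u := by
    unfold auxE
    simp only [Set.mem_ofPred_eq]
    refine and_congr (forall_congr' fun i => ?_) (forall_congr' fun j => imp_congr_right fun _ => ?_)
    · simp only [Pi.add_apply, Pi.smul_apply, smul_eq_mul]
      rw [lt_add_iff_pos_right, mul_pos_iff_of_pos_left (inv_pos.mpr hu)]
    · rw [add_assoc, mulVec_add M (u • c0), mulVec_smul]
      simp only [Pi.add_apply, Pi.smul_apply, smul_eq_mul]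
      constructor <;> intro h <;> linarith
  by_cases hz : (z, y) ∈ auxE M c0 a b K u
  · rw [Set.indicator_of_mem hz, hG, Set.indicator_of_mem (hiff.mpr hz)]
    unfold auxf
    rw [← ENNReal.ofReal_mul hk0]
    congr 1
    simp only [add_sub_cancel_right]
    rw [aux_expand Q hQ c0 a z hu]
    ring
  · rw [Set.indicator_of_notMem hz, hG, Set.indicator_of_notMem (fun h => hz (hiff.mp h)), mul_zero]

/-- bounding function in the first block -/
def auxg {m : Type*} [Fintype m] (w : m → ℝ) : (m → ℝ) → ℝ≥0∞ :=
  {z : m → ℝ | ∀ i, 0 < z i}.indicator fun z => ENNReal.ofReal (Real.exp (-(w ⬝ᵥ z)))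

lemma aux_posset {m : Type*} [Fintype m] : MeasurableSet {z : m → ℝ | ∀ i, 0 < z i} := by
  simp only [Set.ofPred_forall]
  exact MeasurableSet.iInter fun i => measurableSet_lt measurable_const (by fun_prop)

lemma aux_measg {m : Type*} [Fintype m] (w : m → ℝ) : Measurable (auxg w) := by
  unfold auxg
  refine Measurable.indicator ?_ aux_posset
  have : Continuous fun z : m → ℝ => Real.exp (-(w ⬝ᵥ z)) := by fun_prop
  exact this.measurable.ennreal_ofReal

lemma aux_g_fin {m : Type*} [Fintype m] (w : m → ℝ) (hw : ∀ i, 0 < w i) :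
    ∫⁻ z, auxg w z ≠ ∞ := by
  have hint : Integrable (fun z : m → ℝ =>
      ∏ i, (Set.Ioi (0:ℝ)).indicator (fun t => Real.exp (-(w i) * t)) (z i)) := by
    refine Integrable.fintype_prod
      (f := fun i => (Set.Ioi (0:ℝ)).indicator (fun t => Real.exp (-(w i) * t))) fun i => ?_
    rw [integrable_indicator_iff measurableSet_Ioi]
    exact integrableOn_exp_mul_Ioi (by linarith [hw i]) 0
  have h2 := hint.hasFiniteIntegral
  refine ne_of_lt (lt_of_le_of_lt (lintegral_mono fun z => ?_) h2)
  unfold auxg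
  by_cases hz : z ∈ {z : m → ℝ | ∀ i, 0 < z i}
  · rw [Set.indicator_of_mem hz]
    have : ∀ i, (Set.Ioi (0:ℝ)).indicator (fun t => Real.exp (-(w i) * t)) (z i) =
        Real.exp (-(w i) * z i) := fun i => Set.indicator_of_mem (hz i) _
    simp only [this]
    rw [← Real.exp_sum, Real.enorm_of_nonneg (by positivity)]
    simp [dotProduct]
  · rw [Set.indicator_of_notMem hz]; simp

lemma aux_g_pos {m : Type*} [Fintype m] (w : m → ℝ) :
    ∫⁻ z, auxg w z ≠ 0 := by
  intro h0
  rw [lintegral_eq_zero_iff (aux_measg w)] at h0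
  have hopen : IsOpen {z : m → ℝ | ∀ i, 0 < z i} := by
    simp only [Set.ofPred_forall]
    exact isOpen_iInter_of_finite fun i => isOpen_lt continuous_const (continuous_apply i)
  have hpos : 0 < volume {z : m → ℝ | ∀ i, 0 < z i} :=
    hopen.measure_pos _ ⟨fun _ => 1, fun _ => one_pos⟩
  have : volume {z : m → ℝ | ∀ i, 0 < z i} = 0 := by
    refine measure_mono_null ?_ h0
    intro z hz
    simp only [Set.mem_compl_iff]
    intro h
    have h' : auxg w z = 0 := h
    unfold auxg at h'
    rw [Set.indicator_of_mem hz] at h'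
    rw [ENNReal.ofReal_eq_zero] at h'
    exact absurd (Real.exp_pos _) (not_lt.mpr h')
  exact hpos.ne' this

lemma aux_f_le {m n : Type*} [Fintype m] [DecidableEq m] [Fintype n] [DecidableEq n]
    (Q : Matrix m m ℝ) (hQ : Q.PosDef) (S : Matrix n n ℝ) (M : Matrix n m ℝ)
    (c0 a : m → ℝ) (b : n → ℝ) (K : n → Prop) (u : ℝ) (z : (m → ℝ) × (n → ℝ)) :
    (auxE M c0 a b K u).indicator (auxf Q S c0 a u) z ≤
      auxg (Q⁻¹ *ᵥ c0) z.1 * ENNReal.ofReal (gaussPDF S z.2) := by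
  by_cases hz : z ∈ auxE M c0 a b K u
  · rw [Set.indicator_of_mem hz]
    have hz1 : z.1 ∈ {z : m → ℝ | ∀ i, 0 < z i} := hz.1
    unfold auxg auxf
    rw [Set.indicator_of_mem hz1, ← ENNReal.ofReal_mul (by positivity)]
    refine ENNReal.ofReal_le_ofReal ?_
    refine mul_le_mul_of_nonneg_right ?_ (aux_gaussPDF_nonneg S _)
    refine mul_le_of_le_one_right (by positivity) ?_
    rw [Real.exp_le_one_iff]
    have := hQ.inv.posSemidef.dotProduct_mulVec_nonneg (a + u⁻¹ • z.1)
    simp only [star_trivial] at this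
    linarith
  · rw [Set.indicator_of_notMem hz]; simp

lemma aux_limit {m n : Type*} [Fintype m] [DecidableEq m] [Fintype n] [DecidableEq n]
    (Q : Matrix m m ℝ) (hQ : Q.PosDef) (S : Matrix n n ℝ) (hS : S.PosDef) (M : Matrix n m ℝ)
    (c0 : m → ℝ) (hw : ∀ i, 0 < (Q⁻¹ *ᵥ c0) i) (a : ℝ → m → ℝ) (a0 : m → ℝ)
    (ha : Tendsto a atTop (𝓝 a0)) (b : ℝ → n → ℝ) (K N : n → Prop) (t : n → ℝ)
    (hN : ∀ j, K j → N j → Tendsto (fun u => b u j - u * (M *ᵥ c0) j) atTop (𝓝 (t j)))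
    (hN' : ∀ j, K j → ¬ N j → Tendsto (fun u => b u j - u * (M *ᵥ c0) j) atTop atBot) :
    Tendsto (fun u => ∫⁻ z, (auxE M c0 (a u) (b u) K u).indicator (auxf Q S c0 (a u) u) z) atTop
      (𝓝 (ENNReal.ofReal (Real.exp (-(a0 ⬝ᵥ Q⁻¹ *ᵥ a0) / 2)) * (∫⁻ z, auxg (Q⁻¹ *ᵥ c0) z) *
        ∫⁻ y, {y : n → ℝ | ∀ j, K j → N j → t j < y j}.indicator
          (fun y => ENNReal.ofReal (gaussPDF S (y - M *ᵥ a0))) y)) := by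
  set w := Q⁻¹ *ᵥ c0 with hwdef
  set θ : n → ℝ := fun j => t j - (M *ᵥ a0) j with hθ
  set V : Set (n → ℝ) := {y : n → ℝ | ∀ j, K j → N j → θ j < y j} with hV
  have hVm : MeasurableSet V := by
    rw [hV]
    simp only [Set.ofPred_forall]
    exact MeasurableSet.iInter fun j => MeasurableSet.iInter fun _ => MeasurableSet.iInter fun _ =>
      measurableSet_lt measurable_const (by fun_prop)
  have hSm : Measurable fun y => ENNReal.ofReal (gaussPDF S y) :=
    (aux_gaussPDF_cont S).measurable.ennreal_ofReal
  set E0 := Real.exp (-(a0 ⬝ᵥ Q⁻¹ *ᵥ a0) / 2) with hE0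
  have hlim : ENNReal.ofReal E0 * (∫⁻ z, auxg w z) *
        ∫⁻ y, {y : n → ℝ | ∀ j, K j → N j → t j < y j}.indicator
          (fun y => ENNReal.ofReal (gaussPDF S (y - M *ᵥ a0))) y =
      ∫⁻ z : (m → ℝ) × (n → ℝ), (ENNReal.ofReal E0 * auxg w z.1) *
        V.indicator (fun y => ENNReal.ofReal (gaussPDF S y)) z.2 := by
    rw [Measure.volume_eq_prod, lintegral_prod_mul
      (f := fun z => ENNReal.ofReal E0 * auxg w z)
      (g := V.indicator (fun y => ENNReal.ofReal (gaussPDF S y)))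
      ((aux_measg w).const_mul _).aemeasurable
      (hSm.indicator hVm).aemeasurable, lintegral_const_mul _ (aux_measg w)]
    congr 1
    rw [← lintegral_add_right_eq_self _ (M *ᵥ a0)]
    congr 1
    ext y
    have : y + M *ᵥ a0 ∈ {y : n → ℝ | ∀ j, K j → N j → t j < y j} ↔ y ∈ V := by
      rw [hV]
      simp only [Set.mem_ofPred_eq, hθ, Pi.add_apply, sub_lt_iff_lt_add]
    by_cases hy : y ∈ V
    · rw [Set.indicator_of_mem hy, Set.indicator_of_mem (this.mpr hy), add_sub_cancel_right]
    · rw [Set.indicator_of_notMem hy, Set.indicator_of_notMem (fun h => hy (this.mp h))]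
  rw [hlim]
  refine tendsto_lintegral_filter_of_dominated_convergence
    (fun z => auxg w z.1 * ENNReal.ofReal (gaussPDF S z.2)) ?_ ?_ ?_ ?_
  · exact Eventually.of_forall fun u =>
      (aux_measf Q S c0 (a u) u).indicator (aux_measE M c0 (a u) (b u) K u)
  · exact Eventually.of_forall fun u => Eventually.of_forall fun z =>
      aux_f_le Q hQ S M c0 (a u) (b u) K u z
  · rw [Measure.volume_eq_prod, lintegral_prod_mul (f := auxg w)
      (g := fun y => ENNReal.ofReal (gaussPDF S y)) (aux_measg w).aemeasurable hSm.aemeasurable,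
      aux_gauss_one S hS, mul_one]
    exact aux_g_fin w hw
  · have hae : ∀ᵐ z : (m → ℝ) × (n → ℝ), ∀ j, z.2 j ≠ θ j := by
      rw [ae_all_iff]
      intro j
      have h1 : ∀ᵐ y : n → ℝ, y j ≠ θ j := by
        rw [ae_iff]
        simp only [not_not]
        exact Measure.pi_hyperplane (α := fun _ : n => ℝ) (fun _ => volume) j (θ j)
      exact (Measure.quasiMeasurePreserving_snd (μ := (volume : Measure (m → ℝ)))
        (ν := (volume : Measure (n → ℝ)))).ae h1
    filter_upwards [hae] with z hz
    have hinv : Tendsto (fun u : ℝ => a u + u⁻¹ • z.1) atTop (𝓝 a0) := by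
      have h2 : Tendsto (fun u : ℝ => u⁻¹ • z.1) atTop (𝓝 ((0:ℝ) • z.1)) :=
        tendsto_inv_atTop_zero.smul_const z.1
      simpa using ha.add h2
    have hM : ∀ j, Tendsto (fun u : ℝ => (M *ᵥ (a u + u⁻¹ • z.1)) j) atTop (𝓝 ((M *ᵥ a0) j)) := by
      intro j
      have hc : Continuous fun v : m → ℝ => (M *ᵥ v) j := by fun_prop
      exact (hc.tendsto a0).comp hinv
    have hf : Tendsto (fun u => auxf Q S c0 (a u) u z) atTop
        (𝓝 (ENNReal.ofReal (Real.exp (-(w ⬝ᵥ z.1)) * E0 * gaussPDF S z.2))) := by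
      unfold auxf
      refine ENNReal.tendsto_ofReal ?_
      refine Tendsto.mul_const _ (Tendsto.const_mul _ ?_)
      have hc : Continuous fun v : m → ℝ => Real.exp (-(v ⬝ᵥ Q⁻¹ *ᵥ v) / 2) := by fun_prop
      exact (hc.tendsto a0).comp hinv
    have hev : ∀ᶠ u in atTop, z ∈ auxE M c0 (a u) (b u) K u ↔ (∀ i, 0 < z.1 i) ∧ z.2 ∈ V := by
      have : ∀ j, ∀ᶠ u in atTop,
          (K j → b u j - u * (M *ᵥ c0) j - (M *ᵥ (a u + u⁻¹ • z.1)) j < z.2 j) ↔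
            (K j → N j → θ j < z.2 j) := by
        intro j
        by_cases hK : K j
        swap
        · exact Eventually.of_forall fun u => by simp [hK]
        by_cases hNj : N j
        · have hl := (hN j hK hNj).sub (hM j)
          rcases lt_or_gt_of_ne (hz j) with h | h
          · filter_upwards [hl.eventually_const_lt h] with u hu
            simp only [hK, hNj, forall_true_left]
            exact ⟨fun h' => absurd h' (not_lt.mpr hu.le), fun h' => absurd h' (not_lt.mpr h.le)⟩
          · filter_upwards [hl.eventually_lt_const h] with u hu
            simp only [hK, hNj, forall_true_left]
            exact ⟨fun _ => h, fun _ => hu⟩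
        · have hl : Tendsto (fun u => b u j - u * (M *ᵥ c0) j - (M *ᵥ (a u + u⁻¹ • z.1)) j)
              atTop atBot := by
            simpa [sub_eq_add_neg] using (hN' j hK hNj).atBot_add (hM j).neg
          filter_upwards [hl.eventually_lt_atBot (z.2 j)] with u hu
          simp [hNj, hu]
      filter_upwards [eventually_all.mpr this] with u hu
      unfold auxE
      rw [hV]
      simp only [Set.mem_ofPred_eq]
      exact and_congr_right fun _ => forall_congr' hu
    by_cases hmem : (∀ i, 0 < z.1 i) ∧ z.2 ∈ V
    · have hz1 : z.1 ∈ {z : m → ℝ | ∀ i, 0 < z i} := hmem.1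
      rw [Set.indicator_of_mem hmem.2]
      unfold auxg
      rw [Set.indicator_of_mem hz1, ← ENNReal.ofReal_mul (by positivity),
        ← ENNReal.ofReal_mul (by positivity), mul_comm E0]
      refine hf.congr' ?_
      filter_upwards [hev] with u hu
      rw [Set.indicator_of_mem (hu.mpr hmem)]
    · have h0 : ENNReal.ofReal E0 * auxg w z.1 *
          V.indicator (fun y => ENNReal.ofReal (gaussPDF S y)) z.2 = 0 := by
        by_cases hz1 : z.1 ∈ {z : m → ℝ | ∀ i, 0 < z i}
        · rw [Set.indicator_of_notMem (fun h => hmem ⟨hz1, h⟩), mul_zero]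
        · unfold auxg
          rw [Set.indicator_of_notMem hz1, mul_zero, zero_mul]
      rw [h0]
      refine tendsto_const_nhds.congr' ?_
      filter_upwards [hev] with u hu
      rw [Set.indicator_of_notMem (fun h => hmem (hu.mp h))]

lemma aux_prob {Ω : Type*} [MeasurableSpace Ω] (P : Measure Ω)
    {d : ℕ} (A : Matrix (Fin d) (Fin d) ℝ) (hA : A.PosDef)
    (X : Ω → Fin d → ℝ) (hX : Measurable X) (hG : IsCenteredGaussianRV P X A)
    (c x : Fin d → ℝ) (I K : Finset (Fin d)) (hIK : I ⊆ K) {u : ℝ} (hu : 0 < u) :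
    P {ω | ∀ i ∈ K, c i * u + x i < X ω i} =
      ENNReal.ofReal (auxκ (subM A I I) (subV c I) (subV x I) u) *
      ∫⁻ z, (auxE (subM A Iᶜ I * (subM A I I)⁻¹) (subV c I) (subV x I)
          (fun j : ↥Iᶜ => c j * u + x j) (fun j => (j : Fin d) ∈ K) u).indicator
        (auxf (subM A I I) (schurC A I) (subV c I) (subV x I) u) z := by
  have hQ : (subM A I I).PosDef := hA.submatrix (e := fun i : ↥I => (i : Fin d))
    Subtype.val_injective
  have hsymm : ∀ i j, A i j = A j i := fun i j => by
    have := congrFun (congrFun hA.isHermitian.eq j) i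
    simpa [conjTranspose_apply] using this
  have hR : (subM A I Iᶜ)ᵀ = subM A Iᶜ I := by
    ext i j; exact hsymm _ _
  rw [← aux_cov _ hQ _ _ _ _ _ _ hu]
  let e : ↥I ⊕ ↥Iᶜ ≃ Fin d := Equiv.ofBijective (Sum.elim (fun i => (i : Fin d)) (fun j => (j : Fin d))) (by
    constructor
    · rintro (i | i) (j | j) h
      · exact congrArg _ (Subtype.ext h)
      · exact absurd i.2 (by have := Finset.mem_compl.mp j.2; simp only [Sum.elim_inl, Sum.elim_inr] at h; rwa [← h] at this)
      · exact absurd j.2 (by have := Finset.mem_compl.mp i.2; simp only [Sum.elim_inl, Sum.elim_inr] at h; rwa [h] at this)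
      · exact congrArg _ (Subtype.ext h)
    · intro i
      by_cases h : i ∈ I
      · exact ⟨Sum.inl ⟨i, h⟩, rfl⟩
      · exact ⟨Sum.inr ⟨i, Finset.mem_compl.mpr h⟩, rfl⟩)
  have hAe : A.submatrix e e = fromBlocks (subM A I I) (subM A I Iᶜ) (subM A I Iᶜ)ᵀ (subM A Iᶜ Iᶜ) := by
    rw [hR]
    ext (i | i) (j | j) <;> rfl
  have hAep : (fromBlocks (subM A I I) (subM A I Iᶜ) (subM A I Iᶜ)ᵀ (subM A Iᶜ Iᶜ)).PosDef := by
    rw [← hAe]; exact hA.submatrix e.injective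
  have hpdf : ∀ v : Fin d → ℝ, gaussPDF A v = gaussPDF (subM A I I) (fun i : ↥I => v i) *
      gaussPDF (schurC A I) ((fun j : ↥Iᶜ => v j) -
        (subM A Iᶜ I * (subM A I I)⁻¹) *ᵥ (fun i : ↥I => v i)) := by
    intro v
    have hv : v ∘ e = Sum.elim (fun i : ↥I => v i) (fun j : ↥Iᶜ => v j) := by
      ext (i | i) <;> rfl
    rw [aux_reindex e A v, hAe, hv, aux_factor _ _ _ hAep hQ, hR, mulVec_mulVec]
    rfl
  set U : Set ((↥I → ℝ) × (↥Iᶜ → ℝ)) :=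
    {z | (∀ i, u * subV c I i + subV x I i < z.1 i) ∧
      ∀ j : ↥Iᶜ, (j : Fin d) ∈ K → c j * u + x j < z.2 j} with hU
  have hUm : MeasurableSet U := by
    rw [hU]
    simp only [Set.ofPred_and, Set.ofPred_forall]
    refine MeasurableSet.inter (MeasurableSet.iInter fun i => ?_)
      (MeasurableSet.iInter fun j => MeasurableSet.iInter fun _ => ?_)
    · exact measurableSet_lt measurable_const (by fun_prop)
    · exact measurableSet_lt measurable_const (by fun_prop)
  set f : (↥I → ℝ) × (↥Iᶜ → ℝ) → ℝ≥0∞ := fun z => ENNReal.ofReal (gaussPDF (subM A I I) z.1 *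
    gaussPDF (schurC A I) (z.2 - (subM A Iᶜ I * (subM A I I)⁻¹) *ᵥ z.1)) with hf
  have hfm : Measurable f := by
    have h1 := aux_gaussPDF_cont (subM A I I)
    have h2 := aux_gaussPDF_cont (schurC A I)
    have : Continuous fun z : (↥I → ℝ) × (↥Iᶜ → ℝ) => gaussPDF (subM A I I) z.1 *
      gaussPDF (schurC A I) (z.2 - (subM A Iᶜ I * (subM A I I)⁻¹) *ᵥ z.1) := by fun_prop
    exact this.measurable.ennreal_ofReal
  rw [← lintegral_prod (fun z => U.indicator f z) (hfm.indicator hUm).aemeasurable]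
  have mp : MeasurePreserving (fun v : Fin d → ℝ => ((fun i : ↥I => v i), (fun j : ↥Iᶜ => v j)))
      volume ((volume : Measure (↥I → ℝ)).prod (volume : Measure (↥Iᶜ → ℝ))) := by
    have h1 := volume_measurePreserving_sumPiEquivProdPi (fun _ : ↥I ⊕ ↥Iᶜ => ℝ)
    have h2 := (volume_measurePreserving_piCongrLeft (fun _ : Fin d => ℝ) e).symm
    have h3 := h1.comp h2
    exact h3
  rw [← mp.lintegral_comp (hfm.indicator hUm)]
  have hset : MeasurableSet {v : Fin d → ℝ | ∀ i ∈ K, c i * u + x i < v i} := by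
    simp only [Set.ofPred_forall]
    exact MeasurableSet.iInter fun i => MeasurableSet.iInter fun _ =>
      measurableSet_lt measurable_const (by fun_prop)
  have hmap : P {ω | ∀ i ∈ K, c i * u + x i < X ω i} =
      (Measure.map X P) {v : Fin d → ℝ | ∀ i ∈ K, c i * u + x i < v i} := by
    rw [Measure.map_apply hX hset]; rfl
  rw [hmap, hG, withDensity_apply _ hset, ← lintegral_indicator hset]
  congr 1
  ext v
  have hiff : ((fun i : ↥I => v i), (fun j : ↥Iᶜ => v j)) ∈ U ↔
      v ∈ {v : Fin d → ℝ | ∀ i ∈ K, c i * u + x i < v i} := by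
    rw [hU]
    simp only [Set.mem_ofPred_eq, subV]
    constructor
    · rintro ⟨h1, h2⟩ i hi
      by_cases hiI : i ∈ I
      · have := h1 ⟨i, hiI⟩
        rwa [mul_comm] at this
      · exact h2 ⟨i, Finset.mem_compl.mpr hiI⟩ hi
    · intro h
      refine ⟨fun i => ?_, fun j hj => h j hj⟩
      rw [mul_comm]; exact h i (hIK i.2)
  by_cases hv : v ∈ {v : Fin d → ℝ | ∀ i ∈ K, c i * u + x i < v i}
  · rw [Set.indicator_of_mem hv, Set.indicator_of_mem (hiff.mpr hv), hpdf v]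
  · rw [Set.indicator_of_notMem hv, Set.indicator_of_notMem (fun h => hv (hiff.mp h))]

/-- Lemma 4.2 (second part): with `I, L` the index sets of `Π_Σ(c)`, `N = L \ I`,
`x(u)/u → 0` and `(x(u))_{I∪N} → x_{I∪N}`, one has
`lim_u P(X > cu + x(u))/P(X_I > (cu+x(u))_I)
 = lim_u P(X_L > (cu+x(u))_L)/P(X_I > (cu+x(u))_I) = P(X_N > x_N | X_I = x_I)`
(the latter probability being `1` if `N` is empty). -/
theorem gaussian_tail_ratio_limit
    {Ω : Type*} [MeasurableSpace Ω] (P : Measure Ω) [IsProbabilityMeasure P]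
    {d : ℕ} (A : Matrix (Fin d) (Fin d) ℝ) (hA : A.PosDef)
    (X : Ω → Fin d → ℝ) (hX : Measurable X) (hG : IsCenteredGaussianRV P X A)
    (c : Fin d → ℝ) (hc : ∃ i, 0 < c i)
    (bt : Fin d → ℝ) (I L : Finset (Fin d))
    (hsol : IsQPSol A c bt) (hI : IsQPIndex A c bt I) (hL : ∀ i, i ∈ L ↔ bt i = c i)
    (x : ℝ → Fin d → ℝ) (hx : ∀ i, Tendsto (fun u => x u i / u) atTop (𝓝 0))
    (xl : Fin d → ℝ)
    (hxl : ∀ i ∈ I ∪ (L \ I), Tendsto (fun u => x u i) atTop (𝓝 (xl i))) :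
    Tendsto (fun u =>
        (P {ω | ∀ i, c i * u + x u i < X ω i}).toReal /
          (P {ω | ∀ i ∈ I, c i * u + x u i < X ω i}).toReal) atTop
      (𝓝 ((condNuAt A I xl
        {y : ↥Iᶜ → ℝ | ∀ j : ↥Iᶜ, (j : Fin d) ∈ L \ I → xl j < y j}).toReal)) ∧
    Tendsto (fun u =>
        (P {ω | ∀ i ∈ L, c i * u + x u i < X ω i}).toReal /
          (P {ω | ∀ i ∈ I, c i * u + x u i < X ω i}).toReal) atTop
      (𝓝 ((condNuAt A I xl
        {y : ↥Iᶜ → ℝ | ∀ j : ↥Iᶜ, (j : Fin d) ∈ L \ I → xl j < y j}).toReal)) := by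
  have hQ : (subM A I I).PosDef := hA.submatrix (e := fun i : ↥I => (i : Fin d))
    Subtype.val_injective
  have hS : (schurC A I).PosDef := by
    have hsymm : ∀ i j, A i j = A j i := fun i j => by
      have := congrFun (congrFun hA.isHermitian.eq j) i
      simpa [conjTranspose_apply] using this
    have hR : (subM A I Iᶜ)ᵀ = subM A Iᶜ I := by
      ext i j; exact hsymm _ _
    have hinj : Function.Injective
        (Sum.elim (fun i : ↥I => (i : Fin d)) (fun j : ↥Iᶜ => (j : Fin d))) :=
      Function.Injective.sumElim Subtype.val_injective Subtype.val_injective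
        (fun i j h => Finset.mem_compl.mp j.2 (h ▸ i.2))
    have hAe : (fromBlocks (subM A I I) (subM A I Iᶜ) (subM A I Iᶜ)ᵀ (subM A Iᶜ Iᶜ)).PosDef := by
      have h := hA.submatrix hinj
      convert h using 1
      rw [hR]
      ext (i | i) (j | j) <;> rfl
    have h := (aux_schur_posDef _ _ _ hAe hQ).1
    rw [hR] at h
    exact h
  obtain ⟨hIne, hbI, hw, hbt⟩ := hI
  have hIL : I ⊆ L := fun i hi => (hL i).mpr (hbI i hi)
  have hMc : ∀ j : ↥Iᶜ, ((subM A Iᶜ I * (subM A I I)⁻¹) *ᵥ subV c I) j = bt j := by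
    intro j
    rw [hbt j (Finset.mem_compl.mp j.2), ← mulVec_mulVec]
    rfl
  have ha : Tendsto (fun u => subV (x u) I) atTop (𝓝 (subV xl I)) := by
    rw [tendsto_pi_nhds]
    intro i
    exact hxl i (Finset.mem_union_left _ i.2)
  set ν := condNuAt A I xl with hν
  set NN : Set (↥Iᶜ → ℝ) := {y : ↥Iᶜ → ℝ | ∀ j : ↥Iᶜ, (j : Fin d) ∈ L \ I → xl j < y j} with hNN
  set C0 : ℝ≥0∞ := ENNReal.ofReal (Real.exp (-(subV xl I ⬝ᵥ (subM A I I)⁻¹ *ᵥ subV xl I) / 2)) *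
    (∫⁻ z, auxg ((subM A I I)⁻¹ *ᵥ subV c I) z) with hC0
  have hC0ne : C0 ≠ 0 := mul_ne_zero (by simpa using Real.exp_pos _) (aux_g_pos _)
  have hC0top : C0 ≠ ∞ := ENNReal.mul_ne_top ENNReal.ofReal_ne_top (aux_g_fin _ hw)
  let V : Finset (Fin d) → ℝ → ℝ≥0∞ := fun K u =>
    ∫⁻ z, (auxE (subM A Iᶜ I * (subM A I I)⁻¹) (subV c I) (subV (x u) I)
          (fun j : ↥Iᶜ => c j * u + x u j) (fun j => (j : Fin d) ∈ K) u).indicator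
        (auxf (subM A I I) (schurC A I) (subV c I) (subV (x u) I) u) z
  have hset : ∀ (T : Set (↥Iᶜ → ℝ)), MeasurableSet T → ν T =
      ∫⁻ y, T.indicator (fun y => ENNReal.ofReal (gaussPDF (schurC A I)
        (y - (subM A Iᶜ I * (subM A I I)⁻¹) *ᵥ subV xl I))) y := by
    intro T hT
    rw [hν]
    unfold condNuAt
    rw [withDensity_apply _ hT, ← lintegral_indicator hT]
    simp only [mulVec_mulVec]
  have hνuniv : ν Set.univ = 1 := by
    rw [hset _ MeasurableSet.univ]
    simp only [Set.indicator_univ]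
    rw [lintegral_sub_right_eq_self (fun y => ENNReal.ofReal (gaussPDF (schurC A I) y))]
    exact aux_gauss_one _ hS
  have hVlim : ∀ K : Finset (Fin d), Tendsto (V K) atTop
      (𝓝 (C0 * ν {y : ↥Iᶜ → ℝ | ∀ j : ↥Iᶜ, (j : Fin d) ∈ K → (j : Fin d) ∈ L → xl j < y j})) := by
    intro K
    rw [hset]
    · refine aux_limit _ hQ _ hS _ _ hw _ _ ha (fun u j => c j * u + x u j)
        (fun j => (j : Fin d) ∈ K) (fun j => (j : Fin d) ∈ L) (fun j => xl j) ?_ ?_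
      · intro j _ hj
        have h := hxl j (Finset.mem_union_right _
          (Finset.mem_sdiff.mpr ⟨hj, Finset.mem_compl.mp j.2⟩))
        refine h.congr fun u => ?_
        rw [hMc, (hL j).mp hj]; ring
      · intro j _ hj
        have hlt : c j - bt j < 0 :=
          sub_neg.mpr (lt_of_le_of_ne (hsol.1 j) (fun h => hj ((hL j).mpr h.symm)))
        have h1 : Tendsto (fun u => (c j - bt j) + x u j / u) atTop (𝓝 (c j - bt j)) := by
          simpa using (hx j).const_add (c j - bt j)
        refine (h1.neg_mul_atTop hlt tendsto_id).congr' ?_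
        filter_upwards [eventually_gt_atTop 0] with u hu
        rw [hMc]
        simp only [id]
        field_simp
        ring
    · simp only [Set.ofPred_forall]
      exact MeasurableSet.iInter fun i => MeasurableSet.iInter fun _ => MeasurableSet.iInter fun _ =>
        measurableSet_lt measurable_const (by fun_prop)
  have hVI : Tendsto (V I) atTop (𝓝 C0) := by
    have := hVlim I
    have huniv : {y : ↥Iᶜ → ℝ | ∀ j : ↥Iᶜ, (j : Fin d) ∈ I → (j : Fin d) ∈ L → xl j < y j} =
        Set.univ := by
      ext y
      simp only [Set.mem_ofPred_eq, Set.mem_univ, iff_true]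
      intro j hj
      exact absurd hj (Finset.mem_compl.mp j.2)
    rwa [huniv, hνuniv, mul_one] at this
  have main : ∀ K : Finset (Fin d), L ⊆ K → Tendsto (fun u =>
        (P {ω | ∀ i ∈ K, c i * u + x u i < X ω i}).toReal /
          (P {ω | ∀ i ∈ I, c i * u + x u i < X ω i}).toReal) atTop (𝓝 (ν NN).toReal) := by
    intro K hK
    have hVK : Tendsto (V K) atTop (𝓝 (C0 * ν NN)) := by
      have h := hVlim K
      have hs : {y : ↥Iᶜ → ℝ | ∀ j : ↥Iᶜ, (j : Fin d) ∈ K → (j : Fin d) ∈ L → xl j < y j} = NN := by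
        ext y
        simp only [hNN, Set.mem_ofPred_eq, Finset.mem_sdiff]
        exact forall_congr' fun j => ⟨fun h h' => h (hK h'.1) h'.1,
          fun h _ h' => h ⟨h', Finset.mem_compl.mp j.2⟩⟩
      rwa [hs] at h
    have hνN : ν NN ≠ ∞ := by
      refine ne_of_lt (lt_of_le_of_lt (measure_mono (Set.subset_univ _)) ?_)
      rw [hνuniv]; exact ENNReal.one_lt_top
    have h1 : Tendsto (fun u => (V K u).toReal) atTop (𝓝 (C0 * ν NN).toReal) :=
      (ENNReal.tendsto_toReal (ENNReal.mul_ne_top hC0top hνN)).comp hVK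
    have h2 : Tendsto (fun u => (V I u).toReal) atTop (𝓝 C0.toReal) :=
      (ENNReal.tendsto_toReal hC0top).comp hVI
    have hC0r : C0.toReal ≠ 0 := (ENNReal.toReal_pos hC0ne hC0top).ne'
    have h3 := h1.div h2 hC0r
    rw [ENNReal.toReal_mul, mul_div_cancel_left₀ _ hC0r] at h3
    refine h3.congr' ?_
    filter_upwards [eventually_gt_atTop 0] with u hu
    rw [aux_prob P A hA X hX hG c (x u) I K (hIL.trans hK) hu,
      aux_prob P A hA X hX hG c (x u) I I (Finset.Subset.refl _) hu, ENNReal.toReal_mul,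
      ENNReal.toReal_mul, mul_div_mul_left]
    · rfl
    · rw [ENNReal.toReal_ofReal] <;> unfold auxκ <;> have := hQ.det_pos <;> positivity
  refine ⟨?_, main L (Finset.Subset.refl _)⟩
  have := main Finset.univ (Finset.subset_univ _)
  simpa only [Finset.mem_univ, forall_true_left] using this
end
end
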